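/- Let m ≥ 1, n_i ≥ 1, 1 < p < q < ∞, γ_i < n_i(p-1), and (α_i+n_i)/q = (γ_i+n_i)/p for 1 ≤ i ≤ m. Define 𝓗_m(f)(x) = ∏_{i=1}^m |B(0,|x_i|)|^{-1} ∫_{|y₁|<|x₁|}⋯∫_{|y_m|<|x_m|} f dy (i.e., all β_i = 0). Then ‖𝓗_m‖_{L^p(|x|^γ)→L^q(|x|^α)} = ∏_{i=1}^m |S^{n_i-1}|^{1/q-1/p} n_i^{1/p-1/q} (n_i(p-1)/(n_i(p-1)-γ_i))^{1/p'+1/q} (p'/q)^{1/q} ((p/(q-p)) B(p/(q-p), pq/(q'(q-p))))^{1/q-1/p}. -/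

import Mathlib

open MeasureTheory Set
open scoped ENNReal

/-- The Euler Beta function `B(z,w) = ∫₀¹ t^(z-1) (1-t)^(w-1) dt`. -/
noncomputable def betaFn (z w : ℝ) : ℝ :=
  ∫ t in Ioo (0 : ℝ) 1, t ^ (z - 1) * (1 - t) ^ (w - 1)

/-- Surface area `|S^{n-1}| = 2 π^{n/2} / Γ(n/2)` of the unit sphere. -/
noncomputable def omegaN (n : ℕ) : ℝ :=
  2 * Real.pi ^ ((n : ℝ) / 2) / Real.Gamma ((n : ℝ) / 2)

/-- The Hardy operator `𝓗_m` (all `β_i = 0`) on `ℝ^{n₁} × ⋯ × ℝ^{n_m}`. -/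
noncomputable def prodHardy (m : ℕ) (n : Fin m → ℕ)
    (f : (∀ i, EuclideanSpace ℝ (Fin (n i))) → ℝ≥0∞)
    (x : ∀ i, EuclideanSpace ℝ (Fin (n i))) : ℝ≥0∞ :=
  (∏ i, (volume (Metric.ball (0 : EuclideanSpace ℝ (Fin (n i))) ‖x i‖))⁻¹) *
    ∫⁻ y in {y : ∀ i, EuclideanSpace ℝ (Fin (n i)) | ∀ i, ‖y i‖ < ‖x i‖}, f y

lemma bliss_pointwise {p l q : ℝ} (hp : 1 < p) (hl : 0 < l) (hq : q = p * (1 + l))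
    {G g x T : ℝ} (hG : 0 < G) (hg : 0 ≤ g) (hx : 0 < x) (hT : 0 < T) :
    g * (q - l) * G ^ (q - l - 1) * (x ^ (-((q - l) * (1 - 1 / p))) * T ^ (-(l * (1 - 1 / p)))) +
      G ^ (q - l) * (-((q - l) * (1 - 1 / p)) * x ^ (-((q - l) * (1 - 1 / p)) - 1) *
        T ^ (-(l * (1 - 1 / p))) + x ^ (-((q - l) * (1 - 1 / p))) *
        (G ^ q * x ^ (l - q) / (T ^ l * (1 + T ^ l) ^ (-(q / l))) * -(l * (1 - 1 / p)) *
          T ^ (-(l * (1 - 1 / p)) - 1))) ≤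
      (q - l) * (g ^ p / p + (1 - 1 / p) * (G ^ q * x ^ (l - q) * T ^ (-l))) -
        q * (1 - 1 / p) * (G ^ q * x ^ (l - q) * (1 + T ^ (-l))) := by
  have hp0 : 0 < p := by linarith
  have hq0 : 0 < q := by rw [hq]; positivity
  have hk : 0 < q - l := by rw [hq]; nlinarith
  set c := 1 - 1 / p with hc
  have hc0 : 0 < c := by rw [hc]; simp [inv_lt_one_of_one_lt₀ hp]
  obtain ⟨b, rfl⟩ : ∃ b, G = Real.exp b := ⟨Real.log G, (Real.exp_log hG).symm⟩
  obtain ⟨y, rfl⟩ : ∃ b, x = Real.exp b := ⟨Real.log x, (Real.exp_log hx).symm⟩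
  obtain ⟨t, rfl⟩ : ∃ b, T = Real.exp b := ⟨Real.log T, (Real.exp_log hT).symm⟩
  obtain ⟨s, hs⟩ : ∃ s, 1 + Real.exp t ^ l = Real.exp s :=
    ⟨Real.log _, (Real.exp_log (by positivity)).symm⟩
  have hs' : 1 + Real.exp t ^ (-l) = Real.exp (s - l * t) := by
    rw [sub_eq_add_neg, Real.exp_add, ← hs]
    simp only [← Real.exp_mul]
    rw [add_mul, ← Real.exp_add]
    ring_nf
    simp [add_comm]
  rw [hs, hs']
  simp only [← Real.exp_mul, ← Real.exp_add, ← Real.exp_sub]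
  have young := Real.young_inequality_of_nonneg (a := g)
    (b := Real.exp (b * (q - l - 1) + (y * (-((q - l) * c)) + t * (-(l * c))))) hg (by positivity)
    (Real.HolderConjugate.conjExponent hp)
  have hcp : Real.conjExponent p = 1 / c := by
    rw [Real.conjExponent, hc]; field_simp
  rw [hcp, ← Real.exp_mul] at young
  have amgm := Real.geom_mean_le_arith_mean2_weighted (w₁ := (q - l) / q) (w₂ := l / q)
    (p₁ := 1) (p₂ := Real.exp (y + (b * q + y * (l - q) - (t * l + s * (-(q / l)))) - t))
    (by positivity) (by positivity) (by positivity) (by positivity) (by field_simp; ring)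
  rw [Real.one_rpow, one_mul, ← Real.exp_mul] at amgm
  have e1 : (b * (q - l - 1) + (y * (-((q - l) * c)) + t * (-(l * c)))) * (1 / c) =
      b * q + y * (l - q) + t * (-l) := by
    rw [hc, hq]
    have : p - 1 ≠ 0 := by linarith
    field_simp
    ring
  rw [e1] at young
  have young' := mul_le_mul_of_nonneg_left young hk.le
  have amgm' := mul_le_mul_of_nonneg_left amgm
    (show 0 ≤ q * c * Real.exp (b * (q - l) + y * (-((q - l) * c) - 1) + t * (-(l * c)))
      by positivity)
  have e2 : Real.exp (b * (q - l) + y * (-((q - l) * c) - 1) + t * (-(l * c))) *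
      Real.exp ((y + (b * q + y * (l - q) - (t * l + s * (-(q / l)))) - t) * (l / q)) =
      Real.exp (b * q + y * (l - q) + (s - l * t)) := by
    rw [← Real.exp_add, hc, hq]
    congr 1
    field_simp
    ring
  rw [mul_assoc, e2] at amgm'
  have e3 : g * (q - l) * Real.exp (b * (q - l - 1)) * Real.exp (y * (-((q - l) * c)) + t * (-(l * c)))
      = (q - l) * (g * Real.exp (b * (q - l - 1) + (y * (-((q - l) * c)) + t * (-(l * c))))) := by
    rw [Real.exp_add (b * (q - l - 1))]; ring
  have e4 : Real.exp (b * (q - l)) * (-((q - l) * c) * Real.exp (y * (-((q - l) * c) - 1)) *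
        Real.exp (t * (-(l * c))) + Real.exp (y * (-((q - l) * c))) *
        (Real.exp (b * q + y * (l - q) - (t * l + s * (-(q / l)))) * -(l * c) *
          Real.exp (t * (-(l * c) - 1)))) =
      - (q * c * Real.exp (b * (q - l) + y * (-((q - l) * c) - 1) + t * (-(l * c))) *
        ((q - l) / q * 1 + l / q *
          Real.exp (y + (b * q + y * (l - q) - (t * l + s * (-(q / l)))) - t))) := by
    have : ∀ u v w : ℝ, Real.exp (b * (q - l) + y * (-((q - l) * c) - 1) + t * (-(l * c))) *
      Real.exp (y + (b * q + y * (l - q) - (t * l + s * (-(q / l)))) - t) =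
      Real.exp (b * (q - l)) * Real.exp (y * (-((q - l) * c))) *
        Real.exp (b * q + y * (l - q) - (t * l + s * (-(q / l)))) *
          Real.exp (t * (-(l * c) - 1)) := by
      intros
      simp only [← Real.exp_add]
      congr 1
      ring
    have h2 : Real.exp (b * (q - l) + y * (-((q - l) * c) - 1) + t * (-(l * c))) =
      Real.exp (b * (q - l)) * Real.exp (y * (-((q - l) * c) - 1)) *
        Real.exp (t * (-(l * c))) := by simp only [Real.exp_add]
    calc _ = - c * ((q - l) * (Real.exp (b * (q - l)) * Real.exp (y * (-((q - l) * c) - 1)) *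
        Real.exp (t * (-(l * c)))) + l * (Real.exp (b * (q - l)) * Real.exp (y * (-((q - l) * c))) *
        Real.exp (b * q + y * (l - q) - (t * l + s * (-(q / l)))) *
          Real.exp (t * (-(l * c) - 1)))) := by ring
      _ = _ := by rw [← h2, ← this 0 0 0]; field_simp
  rw [e3, e4, ]
  have e5 : Real.exp (b * q + y * (l - q) + t * -l) / (1 / c) =
    c * Real.exp (b * q + y * (l - q) + t * -l) := by field_simp
  rw [e5] at young'
  linarith

lemma AbsolutelyContinuousOnInterval.lipschitzOnWith_comp {f φ : ℝ → ℝ} {a b : ℝ} {s : Set ℝ}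
    {K : NNReal} (hf : AbsolutelyContinuousOnInterval f a b) (hφ : LipschitzOnWith K φ s)
    (hs : MapsTo f (uIcc a b) s) : AbsolutelyContinuousOnInterval (fun x ↦ φ (f x)) a b := by
  rw [absolutelyContinuousOnInterval_iff] at hf ⊢
  intro ε hε
  obtain ⟨δ, hδ, h⟩ := hf (ε / (K + 1)) (by positivity)
  refine ⟨δ, hδ, fun E hE hEδ ↦ ?_⟩
  calc
    _ ≤ ∑ i ∈ Finset.range E.1, K * dist (f (E.2 i).1) (f (E.2 i).2) :=
      Finset.sum_le_sum fun i hi ↦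
        hφ.dist_le_mul _ (hs (hE.1 i hi).1) _ (hs (hE.1 i hi).2)
    _ = K * ∑ i ∈ Finset.range E.1, dist (f (E.2 i).1) (f (E.2 i).2) := by rw [Finset.mul_sum]
    _ ≤ K * (ε / (K + 1)) := by gcongr; exact (h E hE hEδ).le
    _ < (K + 1) * (ε / (K + 1)) := by gcongr; linarith
    _ = ε := by field

/-- The quantile function of a density bounded away from zero. -/
lemma exists_quantile {w : ℝ → ℝ} (hw : Continuous w) {δ : ℝ} (hδ : 0 < δ)
    (hwδ : ∀ t, δ ≤ w t) (e : ℝ) :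
    ∃ Ψ : ℝ → ℝ, (∀ t, Ψ (∫ s in e..t, w s) = t) ∧ (∀ m, HasDerivAt Ψ (w (Ψ m))⁻¹ m) ∧
      Monotone Ψ := by
  set F : ℝ → ℝ := fun t ↦ ∫ s in e..t, w s with hF
  have hFd : ∀ t, HasDerivAt F (w t) t := fun t ↦
    intervalIntegral.integral_hasDerivAt_right (hw.intervalIntegrable _ _)
      (hw.stronglyMeasurableAtFilter _ _) hw.continuousAt
  have hFc : Continuous F := continuous_iff_continuousAt.2 fun t ↦ (hFd t).continuousAt
  have hFm : StrictMono F := strictMono_of_deriv_pos fun t ↦ by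
    rw [(hFd t).deriv]; exact hδ.trans_le (hwδ t)
  have hlow : ∀ s t, s ≤ t → δ * (t - s) ≤ F t - F s := by
    intro s t hst
    simp only [hF]
    rw [intervalIntegral.integral_interval_sub_left (hw.intervalIntegrable _ _)
      (hw.intervalIntegrable _ _)]
    calc δ * (t - s) = ∫ _ in s..t, δ := by simp [mul_comm]
      _ ≤ _ := intervalIntegral.integral_mono_on hst (by simp) (hw.intervalIntegrable _ _)
        fun x _ ↦ hwδ x
  have hFs : Function.Surjective F := by
    refine hFc.surjective ?_ ?_
    · refine Filter.tendsto_atTop_mono' _ (f₁ := fun t ↦ δ * (t - e)) ?_ ?_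
      · filter_upwards [Filter.eventually_ge_atTop e] with t ht
        have := hlow e t ht
        simpa [hF] using this
      · exact (Filter.tendsto_atTop_add_const_right _ _ Filter.tendsto_id).const_mul_atTop hδ
    · refine Filter.tendsto_atBot_mono' _ (f₁ := fun t ↦ δ * (t - e)) ?_ ?_
      · filter_upwards [Filter.eventually_le_atBot e] with t ht
        have := hlow t e ht
        simp only [hF, intervalIntegral.integral_same] at this ⊢
        linarith
      · exact (Filter.tendsto_atBot_add_const_right _ _ Filter.tendsto_id).const_mul_atBot hδ
  let o := hFm.orderIsoOfSurjective F hFs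
  refine ⟨o.symm, fun t ↦ o.symm_apply_apply t, fun m ↦ ?_, o.symm.monotone⟩
  exact HasDerivAt.of_local_left_inverse o.symm.continuous.continuousAt (hFd _)
    (hδ.trans_le (hwδ _)).ne' (.of_forall fun y ↦ o.apply_symm_apply y)

lemma bliss_transport {p l q : ℝ} (hp : 1 < p) (hl : 0 < l) (hq : q = p * (1 + l))
    {a b ε R : ℝ} (ha : 0 < a) (hab : a ≤ b) (hε : 0 < ε) (hεR : ε ≤ R) {G g : ℝ → ℝ}
    (hGc : Continuous G) (hG0 : ∀ x, 0 ≤ G x) (hGac : AbsolutelyContinuousOnInterval G a b)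
    (hg0 : ∀ x, 0 ≤ g x) (hGd : ∀ᵐ x, x ∈ uIcc a b → HasDerivAt G (g x) x)
    (hgp : IntervalIntegrable (fun x ↦ g x ^ p) volume a b)
    (hmass : ∫ x in a..b, G x ^ q * x ^ (l - q) =
      ∫ t in ε..R, t ^ l * (1 + t ^ l) ^ (-(q / l))) :
    q * (1 - 1 / p) * ((∫ t in ε..R, t ^ l * (1 + t ^ l) ^ (-(q / l))) +
        ∫ t in ε..R, t ^ l * (1 + t ^ l) ^ (-(q / l)) * t ^ (-l)) ≤
      (q - l) * ((∫ x in a..b, g x ^ p) / p +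
        (1 - 1 / p) * ∫ t in ε..R, t ^ l * (1 + t ^ l) ^ (-(q / l)) * t ^ (-l)) +
      G a ^ (q - l) * (a ^ (-((q - l) * (1 - 1 / p))) * ε ^ (-(l * (1 - 1 / p)))) := by
  have hp0 : 0 < p := by linarith
  have hq0 : 0 < q := by rw [hq]; positivity
  have hk : 1 < q - l := by rw [hq]; nlinarith
  have hc0 : 0 < 1 - 1 / p := by simp [inv_lt_one_of_one_lt₀ hp]
  set w₀ : ℝ → ℝ := fun t ↦ t ^ l * (1 + t ^ l) ^ (-(q / l)) with hw₀
  set W : ℝ → ℝ := fun x ↦ G x ^ q * x ^ (l - q) with hW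
  have hw₀pos : ∀ t, 0 < t → 0 < w₀ t := fun t ht ↦ by
    simp only [hw₀]; positivity
  have hw₀c : ContinuousOn w₀ (Ioi 0) := by
    intro t ht
    have ht : 0 < t := ht
    refine ContinuousAt.continuousWithinAt ?_
    have h1 : ContinuousAt (fun t : ℝ ↦ t ^ l) t :=
      Real.continuousAt_rpow_const _ _ (Or.inl ht.ne')
    exact h1.mul ((continuousAt_const.add h1).rpow_const
      (Or.inl (add_pos one_pos (Real.rpow_pos_of_pos ht l)).ne'))
  set w : ℝ → ℝ := fun t ↦ w₀ (projIcc ε R hεR t) with hw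
  have hsub : Icc ε R ⊆ Ioi 0 := fun t ht ↦ hε.trans_le ht.1
  have hwc : Continuous w :=
    hw₀c.comp_continuous (continuous_subtype_val.comp continuous_projIcc)
      fun t ↦ hsub (projIcc ε R hεR t).2
  obtain ⟨t₀, ht₀, hmin⟩ := isCompact_Icc.exists_isMinOn (nonempty_Icc.2 hεR) (hw₀c.mono hsub)
  obtain ⟨Ψ, hΨ, hΨd, hΨm⟩ := exists_quantile hwc (hw₀pos t₀ (hsub ht₀))
    (fun t ↦ hmin (projIcc ε R hεR t).2) ε
  have hww : ∀ t ∈ Icc ε R, w t = w₀ t := fun t ht ↦ by simp [hw, projIcc_of_mem hεR ht]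
  have hwint : ∫ t in ε..R, w t = ∫ t in ε..R, w₀ t :=
    intervalIntegral.integral_congr fun t ht ↦ hww t (by rwa [uIcc_of_le hεR] at ht)
  have hxpos : ∀ x ∈ uIcc a b, 0 < x := fun x hx ↦ by
    rw [uIcc_of_le hab] at hx; exact ha.trans_le hx.1
  have hWc : ContinuousOn W (Ioi 0) := fun x hx ↦ ContinuousAt.continuousWithinAt <|
    (hGc.continuousAt.rpow_const (Or.inr hq0.le)).mul
      (Real.continuousAt_rpow_const _ _ (Or.inl (ne_of_gt hx)))
  have hW0 : ∀ x, 0 < x → 0 ≤ W x := fun x hx ↦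
    mul_nonneg (Real.rpow_nonneg (hG0 x) _) (Real.rpow_nonneg hx.le _)
  have hWi : ∀ x y, 0 < x → 0 < y → IntervalIntegrable W volume x y := fun x y hx hy ↦
    (hWc.mono fun z hz ↦ (lt_min hx hy).trans_le hz.1).intervalIntegrable
  set Φ : ℝ → ℝ := fun x ↦ ∫ s in a..x, W s with hΦ
  have hΦd : ∀ x, 0 < x → HasDerivAt Φ (W x) x := fun x hx ↦
    intervalIntegral.integral_hasDerivAt_right (hWi _ _ ha hx)
      (hWc.stronglyMeasurableAtFilter isOpen_Ioi x hx)
      (hWc.continuousAt (Ioi_mem_nhds hx))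
  set T : ℝ → ℝ := fun x ↦ Ψ (Φ x) with hT
  have hTa : T a = ε := by simpa [hT, hΦ] using hΨ ε
  have hTb : T b = R := by
    have := hΨ R
    rwa [hwint, ← hmass] at this
  have hTmem : ∀ x ∈ uIcc a b, T x ∈ Icc ε R := by
    intro x hx
    have hx' := hx
    rw [uIcc_of_le hab] at hx'
    rw [← hTa, ← hTb]
    have h1 : Φ a ≤ Φ x := by
      simp only [hΦ, intervalIntegral.integral_same]
      exact intervalIntegral.integral_nonneg hx'.1 fun s hs ↦ hW0 s (ha.trans_le hs.1)
    have h2 : Φ x ≤ Φ b := by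
      rw [← sub_nonneg]
      simp only [hΦ]
      rw [intervalIntegral.integral_interval_sub_left (hWi _ _ ha (ha.trans_le hab))
        (hWi _ _ ha (hxpos x hx))]
      exact intervalIntegral.integral_nonneg hx'.2 fun s hs ↦
        hW0 s ((hxpos x hx).trans_le hs.1)
    exact ⟨hΨm h1, hΨm h2⟩
  have hTpos : ∀ x ∈ uIcc a b, 0 < T x := fun x hx ↦ hsub (hTmem x hx)
  have hTd : ∀ x ∈ uIcc a b, HasDerivAt T (W x / w₀ (T x)) x := by
    intro x hx
    have := (hΨd (Φ x)).comp x (hΦd x (hxpos x hx))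
    rw [hww _ (hTmem x hx)] at this
    rw [div_eq_inv_mul]
    exact this
  have hTc : ContinuousOn T (uIcc a b) := fun x hx ↦ (hTd x hx).continuousAt.continuousWithinAt
  have hWc' : ContinuousOn W (uIcc a b) := hWc.mono hxpos
  have hwTc : ContinuousOn (fun x ↦ w₀ (T x)) (uIcc a b) := hw₀c.comp hTc hTpos
  have hTdc : ContinuousOn (fun x ↦ W x / w₀ (T x)) (uIcc a b) :=
    hWc'.div hwTc fun x hx ↦ (hw₀pos _ (hTpos x hx)).ne'
  -- transporting the mass
  have hcv : ∫ x in a..b, W x * T x ^ (-l) = ∫ t in ε..R, w₀ t * t ^ (-l) := by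
    have := intervalIntegral.integral_comp_mul_deriv' (a := a) (b := b) (f := T)
      (f' := fun x ↦ W x / w₀ (T x)) (g := fun t ↦ w₀ t * t ^ (-l)) hTd hTdc ?_
    · rw [hTa, hTb] at this
      rw [← this]
      refine intervalIntegral.integral_congr fun x hx ↦ ?_
      have := (hw₀pos _ (hTpos x hx)).ne'
      simp only [Function.comp]
      field_simp
    · have : T '' uIcc a b ⊆ Ioi 0 := by rintro _ ⟨x, hx, rfl⟩; exact hTpos x hx
      exact (hw₀c.mul fun t ht ↦
        (Real.continuousAt_rpow_const _ _ (Or.inl (ne_of_gt ht))).continuousWithinAt).mono this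
  set c := 1 - 1 / p with hc
  set A : ℝ → ℝ := fun x ↦ x ^ (-((q - l) * c)) * T x ^ (-(l * c)) with hA
  set A' : ℝ → ℝ := fun x ↦ -((q - l) * c) * x ^ (-((q - l) * c) - 1) * T x ^ (-(l * c)) +
      x ^ (-((q - l) * c)) * (W x / w₀ (T x) * -(l * c) * T x ^ (-(l * c) - 1)) with hA'
  have hAd : ∀ x ∈ uIcc a b, HasDerivAt A (A' x) x := fun x hx ↦
    (Real.hasDerivAt_rpow_const (Or.inl (hxpos x hx).ne')).mul
      ((hTd x hx).rpow_const (Or.inl (hTpos x hx).ne'))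
  have hxr : ∀ r : ℝ, ContinuousOn (fun x : ℝ ↦ x ^ r) (uIcc a b) := fun r ↦
    continuousOn_id.rpow_const fun x hx ↦ Or.inl (hxpos x hx).ne'
  have hTr : ∀ r : ℝ, ContinuousOn (fun x : ℝ ↦ T x ^ r) (uIcc a b) := fun r ↦
    hTc.rpow_const fun x hx ↦ Or.inl (hTpos x hx).ne'
  have hA'c : ContinuousOn A' (uIcc a b) :=
    ((continuousOn_const.mul (hxr _)).mul (hTr _)).add
      ((hxr _).mul ((hTdc.mul continuousOn_const).mul (hTr _)))
  have hAac : AbsolutelyContinuousOnInterval A a b := by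
    obtain ⟨M, hM⟩ := isCompact_uIcc.exists_bound_of_continuousOn hA'c
    refine LipschitzOnWith.absolutelyContinuousOnInterval (K := M.toNNReal) ?_
    refine (convex_uIcc a b).lipschitzOnWith_of_nnnorm_hasDerivWithin_le
      (fun x hx ↦ (hAd x hx).hasDerivWithinAt) fun x hx ↦ ?_
    rw [← NNReal.coe_le_coe, coe_nnnorm]
    exact (hM x hx).trans (Real.le_coe_toNNReal M)
  have hGkac : AbsolutelyContinuousOnInterval (fun x ↦ G x ^ (q - l)) a b := by
    obtain ⟨M, hM⟩ := hGac.exists_bound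
    obtain ⟨K, hK⟩ := (Real.contDiff_rpow_const_of_le (n := 1) (p := q - l)
      (by exact_mod_cast hk.le)).contDiffOn.exists_lipschitzOnWith (s := Icc (-M) M) (by simp)
      (convex_Icc _ _) isCompact_Icc
    exact hGac.lipschitzOnWith_comp (φ := fun y ↦ y ^ (q - l)) hK
      fun x hx ↦ abs_le.1 (hM x hx)
  have hSac := hGkac.fun_mul hAac
  set S : ℝ → ℝ := fun x ↦ G x ^ (q - l) * A x with hS
  have hWTi : IntervalIntegrable (fun x ↦ W x * T x ^ (-l)) volume a b :=
    (hWc'.mul (hTr _)).intervalIntegrable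
  have hWi' := hWi a b ha (ha.trans_le hab)
  have hr1 : IntervalIntegrable (fun x ↦ (q - l) * (g x ^ p / p + c * (W x * T x ^ (-l))))
      volume a b :=
    ((hgp.div_const p).add (hWTi.const_mul c)).const_mul _
  have hr2 : IntervalIntegrable (fun x ↦ q * c * (W x + W x * T x ^ (-l))) volume a b :=
    (hWi'.add hWTi).const_mul _
  have hmono : ∫ x in a..b, deriv S x ≤ ∫ x in a..b,
      ((q - l) * (g x ^ p / p + c * (W x * T x ^ (-l))) -
        q * c * (W x + W x * T x ^ (-l))) := by
    refine intervalIntegral.integral_mono_ae_restrict hab hSac.intervalIntegrable_deriv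
      (hr1.sub hr2) ?_
    rw [Filter.EventuallyLE, ae_restrict_iff' measurableSet_Icc]
    filter_upwards [hGd] with x hx hxab
    rw [← uIcc_of_le hab] at hxab
    have hd := ((hx hxab).rpow_const (p := q - l) (Or.inr hk.le)).mul (hAd x hxab)
    rw [show deriv S x = _ from hd.deriv]
    rcases (hG0 x).eq_or_lt with h0 | h0
    · have : W x = 0 := by simp [hW, ← h0, Real.zero_rpow hq0.ne']
      rw [this, ← h0, Real.zero_rpow (by linarith), Real.zero_rpow (by linarith)]
      have := Real.rpow_nonneg (hg0 x) p
      simp only [mul_zero, zero_mul, add_zero, sub_zero]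
      have : 0 < q - l := by linarith
      positivity
    · have := bliss_pointwise hp hl hq h0 (hg0 x) (hxpos x hxab) (hTpos x hxab)
      refine (this.trans_eq ?_)
      simp only [hW]
      ring
  rw [hSac.integral_deriv_eq_sub, intervalIntegral.integral_sub hr1 hr2,
    intervalIntegral.integral_const_mul, intervalIntegral.integral_const_mul,
    intervalIntegral.integral_add (hgp.div_const p) (hWTi.const_mul c),
    intervalIntegral.integral_add hWi' hWTi, intervalIntegral.integral_const_mul,
    intervalIntegral.integral_div, hcv, hmass] at hmono
  have hSb : 0 ≤ S b := mul_nonneg (Real.rpow_nonneg (hG0 _) _)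
    (mul_nonneg (Real.rpow_nonneg (ha.trans_le hab).le _)
      (Real.rpow_nonneg (hTpos b right_mem_uIcc).le _))
  have hSa : S a = G a ^ (q - l) * (a ^ (-((q - l) * c)) * ε ^ (-(l * c))) := by
    simp only [hS, hA, hTa]
  rw [hSa] at hmono
  linarith

lemma integrableOn_Ioi_of_le_one_of_le_rpow {f : ℝ → ℝ} (hf : ContinuousOn f (Ioi 0))
    {r : ℝ} (hr : r < -1) (h0 : ∀ t, 0 < t → 0 ≤ f t) (h1 : ∀ t, 0 < t → t ≤ 1 → f t ≤ 1)
    (h2 : ∀ t, 1 < t → f t ≤ t ^ r) : IntegrableOn f (Ioi 0) := by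
  rw [← Ioc_union_Ioi_eq_Ioi (zero_le_one' ℝ)]
  refine IntegrableOn.union ?_ ?_
  · refine (integrableOn_const (C := (1 : ℝ)) (by simp)).mono'
      (hf.mono Ioc_subset_Ioi_self |>.aestronglyMeasurable measurableSet_Ioc) ?_
    filter_upwards [ae_restrict_mem measurableSet_Ioc] with t ht
    rw [Real.norm_of_nonneg (h0 t ht.1)]
    exact h1 t ht.1 ht.2
  · refine (integrableOn_Ioi_rpow_of_lt hr one_pos).mono'
      (hf.mono (Ioi_subset_Ioi zero_le_one) |>.aestronglyMeasurable measurableSet_Ioi) ?_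
    filter_upwards [ae_restrict_mem measurableSet_Ioi] with t ht
    rw [Real.norm_of_nonneg (h0 t (one_pos.trans ht))]
    exact h2 t ht

lemma continuousOn_one_add_rpow (l r : ℝ) :
    ContinuousOn (fun t : ℝ ↦ (1 + t ^ l) ^ r) (Ioi 0) := fun _ ht ↦
  ((continuousAt_const.add (Real.continuousAt_rpow_const _ _ (Or.inl (ne_of_gt ht)))).rpow_const
    (Or.inl (add_pos one_pos (Real.rpow_pos_of_pos ht l)).ne')).continuousWithinAt

lemma continuousOn_rpow_Ioi (l : ℝ) : ContinuousOn (· ^ l : ℝ → ℝ) (Ioi 0) := fun _ ht ↦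
  (Real.continuousAt_rpow_const _ _ (Or.inl (ne_of_gt ht))).continuousWithinAt

lemma one_add_rpow_le_rpow {l q t : ℝ} (hl : 0 < l) (hq : 0 < q) (ht : 0 < t) :
    (1 + t ^ l) ^ (-(q / l)) ≤ t ^ (-q) := by
  have h : t ^ (-q) = (t ^ l) ^ (-(q / l)) := by
    rw [← Real.rpow_mul ht.le]; congr 1; field_simp
  rw [h]
  exact Real.rpow_le_rpow_of_nonpos (by positivity) (by linarith)
    (by have := div_pos hq hl; linarith)

lemma one_add_rpow_le_one {l r t : ℝ} (hr : r ≤ 0) (ht : 0 < t) : (1 + t ^ l) ^ r ≤ 1 :=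
  Real.rpow_le_one_of_one_le_of_nonpos (by linarith [Real.rpow_pos_of_pos ht l]) hr

lemma integrableOn_one_add_rpow {l q : ℝ} (hl : 0 < l) (hq : 1 < q) :
    IntegrableOn (fun t : ℝ ↦ (1 + t ^ l) ^ (-(q / l))) (Ioi 0) := by
  have := div_pos (one_pos.trans hq) hl
  exact integrableOn_Ioi_of_le_one_of_le_rpow (continuousOn_one_add_rpow _ _)
    (r := -q) (by linarith) (fun t ht ↦ by positivity)
    (fun t ht _ ↦ one_add_rpow_le_one (by linarith) ht)
    (fun t ht ↦ one_add_rpow_le_rpow hl (by linarith) (by linarith))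

lemma integrableOn_rpow_mul_one_add_rpow {l q : ℝ} (hl : 0 < l) (hq : 1 < q - l) :
    IntegrableOn (fun t : ℝ ↦ t ^ l * (1 + t ^ l) ^ (-(q / l))) (Ioi 0) := by
  have hq0 : 0 < q := by linarith
  have := div_pos hq0 hl
  refine integrableOn_Ioi_of_le_one_of_le_rpow
    ((continuousOn_rpow_Ioi l).mul (continuousOn_one_add_rpow _ _))
    (r := l - q) (by linarith) (fun t ht ↦ by positivity) (fun t ht ht1 ↦ ?_) fun t ht ↦ ?_
  · exact mul_le_one₀ (Real.rpow_le_one ht.le ht1 hl.le) (by positivity)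
      (one_add_rpow_le_one (by linarith) ht)
  · have ht0 : 0 < t := by linarith
    rw [sub_eq_add_neg, Real.rpow_add ht0]
    gcongr
    exact one_add_rpow_le_rpow hl hq0 ht0

lemma integral_one_add_rpow_eq {l q : ℝ} (hl : 0 < l) (hq : 1 < q - l) :
    ∫ t in Ioi (0 : ℝ), (1 + t ^ l) ^ (-(q / l)) =
      (q - l - 1) * ∫ t in Ioi (0 : ℝ), t ^ l * (1 + t ^ l) ^ (-(q / l)) := by
  have hi := integrableOn_one_add_rpow hl (show 1 < q by linarith)
  have hj := (integrableOn_rpow_mul_one_add_rpow hl hq).const_mul (q - l - 1)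
  have hlim : Filter.Tendsto (fun t : ℝ ↦ t * (1 + t ^ l) ^ (-((q - l) / l))) Filter.atTop
      (nhds 0) := by
    refine squeeze_zero' (g := fun t ↦ t ^ (-(q - l - 1))) ?_ ?_
      (tendsto_rpow_neg_atTop (by linarith))
    · filter_upwards [Filter.eventually_gt_atTop 0] with t ht
      positivity
    · filter_upwards [Filter.eventually_gt_atTop 0] with t ht
      rw [show -(q - l - 1) = 1 + -(q - l) by ring, Real.rpow_add ht, Real.rpow_one]
      gcongr
      exact one_add_rpow_le_rpow hl (by linarith) ht
  have key := integral_Ioi_of_hasDerivAt_of_tendsto (a := 0)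
    (f' := fun t ↦ (1 + t ^ l) ^ (-(q / l)) -
      (q - l - 1) * (t ^ l * (1 + t ^ l) ^ (-(q / l)))) ?_ ?_ (hi.sub hj) hlim
  · rw [integral_sub hi hj, integral_const_mul] at key
    simp only [zero_mul, sub_zero] at key
    linarith
  · refine ContinuousAt.continuousWithinAt ?_
    have : ContinuousAt (fun t : ℝ ↦ t ^ l) 0 := Real.continuousAt_rpow_const _ _ (Or.inr hl.le)
    exact continuousAt_id.mul ((continuousAt_const.add this).rpow_const
      (Or.inl (by simp [Real.zero_rpow hl.ne'])))
  · intro t ht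
    have ht : 0 < t := ht
    have h1 : 0 < 1 + t ^ l := by positivity
    refine ((hasDerivAt_id t).mul (((Real.hasDerivAt_rpow_const (p := l)
      (Or.inl ht.ne')).const_add 1).rpow_const (p := -((q - l) / l)) (Or.inl h1.ne'))).congr_deriv ?_
    have e1 : (1 + t ^ l) ^ (-((q - l) / l)) = (1 + t ^ l) ^ (-(q / l)) * (1 + t ^ l) := by
      nth_rw 3 [← Real.rpow_one (1 + t ^ l)]
      rw [← Real.rpow_add h1]; congr 1; field_simp; ring
    have e2 : -((q - l) / l) - 1 = -(q / l) := by field_simp; ring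
    have e3 : t ^ l = t * t ^ (l - 1) := by
      rw [Real.rpow_sub_one ht.ne']; field_simp
    rw [e1, e2, e3, id]
    field_simp
    ring

lemma integral_one_add_rpow_eq_betaFn {l q : ℝ} (hl : 0 < l) :
    ∫ t in Ioi (0 : ℝ), (1 + t ^ l) ^ (-(q / l)) = 1 / l * betaFn (1 / l) ((q - 1) / l) := by
  set φ : ℝ → ℝ := fun x ↦ 1 - (1 + x ^ l)⁻¹ with hφ
  set φ' : ℝ → ℝ := fun x ↦ l * x ^ (l - 1) / (1 + x ^ l) ^ 2 with hφ'
  have hpos : ∀ x : ℝ, 0 < x → 0 < 1 + x ^ l := fun x hx ↦ by positivity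
  have himg : φ '' Ioi 0 = Ioo 0 1 := by
    ext y
    constructor
    · rintro ⟨x, hx, rfl⟩
      have hx : 0 < x := hx
      have h1 : 1 < 1 + x ^ l := by linarith [Real.rpow_pos_of_pos hx l]
      have h2 := inv_pos.2 (hpos x hx)
      have h3 := inv_lt_one_of_one_lt₀ h1
      simp only [hφ, mem_Ioo]
      constructor <;> linarith
    · rintro ⟨h0, h1⟩
      have : 0 < 1 - y := by linarith
      refine ⟨(y / (1 - y)) ^ (1 / l), mem_Ioi.2 (by positivity), ?_⟩
      simp only [hφ]
      rw [← Real.rpow_mul (by positivity), one_div_mul_cancel hl.ne', Real.rpow_one]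
      field_simp
      ring
  have hd : ∀ x ∈ Ioi (0 : ℝ), HasDerivWithinAt φ (φ' x) (Ioi 0) x := by
    intro x hx
    have h := (((Real.hasDerivAt_rpow_const (p := l) (Or.inl (ne_of_gt hx))).const_add 1).inv
      (hpos x hx).ne').const_sub 1
    exact h.hasDerivWithinAt.congr_deriv (by simp only [hφ']; ring)
  have hinj : InjOn φ (Ioi 0) := by
    intro x hx y hy h
    simp only [hφ, sub_right_inj, inv_inj, add_right_inj] at h
    exact (Real.rpow_left_inj (le_of_lt hx) (le_of_lt hy) hl.ne').1 h
  rw [betaFn, ← himg, integral_image_eq_integral_abs_deriv_smul measurableSet_Ioi hd hinj,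
    ← integral_const_mul]
  refine setIntegral_congr_fun measurableSet_Ioi fun x hx ↦ ?_
  have hx : 0 < x := hx
  have h1 := hpos x hx
  simp only [smul_eq_mul]
  rw [abs_of_pos (by simp only [hφ']; positivity)]
  have e1 : φ x = x ^ l / (1 + x ^ l) := by simp only [hφ]; field_simp; ring
  have e2 : 1 - φ x = (1 + x ^ l)⁻¹ := by simp [hφ]
  rw [e2, e1]
  obtain ⟨y, rfl⟩ : ∃ b, x = Real.exp b := ⟨Real.log x, (Real.exp_log hx).symm⟩
  obtain ⟨s, hs⟩ : ∃ s, 1 + Real.exp y ^ l = Real.exp s :=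
    ⟨Real.log _, (Real.exp_log h1).symm⟩
  simp only [hφ', hs]
  simp only [← Real.exp_mul, ← Real.exp_sub, ← Real.exp_neg, ← Real.exp_nat_mul]
  have : ∀ u v w : ℝ, l * Real.exp u / Real.exp v * (Real.exp w) = l * Real.exp (u - v + w) := by
    intro u v w; rw [Real.exp_add, Real.exp_sub]; ring
  rw [← Real.exp_add, this, ← mul_assoc, one_div_mul_cancel hl.ne', one_mul]
  congr 1
  push_cast
  field_simp
  ring

lemma intervalIntegral_le_rpow_mul_rpow {p x : ℝ} (hp : 1 < p) (hx : 0 ≤ x) {g : ℝ → ℝ}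
    (hg0 : ∀ x, 0 ≤ g x) (hg : MemLp g (ENNReal.ofReal p)) :
    ∫ t in 0..x, g t ≤ (∫ t in 0..x, g t ^ p) ^ (1 / p) * x ^ (1 - 1 / p) := by
  have h := integral_mul_le_Lp_mul_Lq_of_nonneg (μ := volume.restrict (Ioc 0 x)) (f := g)
    (g := fun _ ↦ (1 : ℝ)) (Real.HolderConjugate.conjExponent hp) (ae_of_all _ hg0)
    (ae_of_all _ fun _ ↦ zero_le_one) (hg.restrict _) (memLp_const _)
  simp only [mul_one, Real.one_rpow, integral_const, smul_eq_mul, measureReal_restrict_apply_univ,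
    Real.volume_real_Ioc_of_le hx, sub_zero] at h
  rw [intervalIntegral.integral_of_le hx, intervalIntegral.integral_of_le hx]
  convert h using 3
  rw [Real.conjExponent]
  have : p - 1 ≠ 0 := by linarith
  field_simp

lemma tendsto_intervalIntegral_Ioi {f : ℝ → ℝ} (hf : IntegrableOn f (Ioi 0)) :
    Filter.Tendsto (fun e : ℝ ↦ ∫ x in e..e⁻¹, f x) (nhdsWithin 0 (Ioi 0))
      (nhds (∫ x in Ioi 0, f x)) := by
  have h1 := intervalIntegral_tendsto_integral_Ioi 0 hf tendsto_inv_nhdsGT_zero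
  have hc : ContinuousOn (fun x ↦ ∫ t in (0 : ℝ)..x, f t) (uIcc 0 1) :=
    intervalIntegral.continuousOn_primitive_interval
      (by rw [uIcc_of_le zero_le_one, integrableOn_Icc_iff_integrableOn_Ioc]
          exact hf.mono_set Ioc_subset_Ioi_self)
  have h2 : Filter.Tendsto (fun e : ℝ ↦ ∫ x in 0..e, f x) (nhdsWithin 0 (Ioi 0)) (nhds 0) := by
    have := hc 0 left_mem_uIcc
    rw [ContinuousWithinAt, intervalIntegral.integral_same, uIcc_of_le zero_le_one] at this
    exact this.mono_left (nhdsWithin_le_of_mem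
      (Filter.mem_of_superset (Ioc_mem_nhdsGT one_pos) Ioc_subset_Icc_self))
  have h := h1.sub h2
  rw [sub_zero] at h
  refine h.congr' ?_
  filter_upwards [self_mem_nhdsWithin] with e he
  have he : 0 < e := he
  have hi : ∀ x : ℝ, 0 < x → IntervalIntegrable f volume 0 x := fun x hx ↦
    (intervalIntegrable_iff_integrableOn_Ioc_of_le hx.le).2 (hf.mono_set Ioc_subset_Ioi_self)
  exact intervalIntegral.integral_interval_sub_left (hi _ (inv_pos.2 he)) (hi _ he)

lemma bliss_contrapositive {p l q a b : ℝ} (hp : 1 < p) (hl : 0 < l) (hq : q = p * (1 + l))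
    (ha : 0 < a) (hab : a ≤ b) {g : ℝ → ℝ} (hg0 : ∀ x, 0 ≤ g x)
    (hg' : ∀ x ≤ 0, g x = 0) (hg : MemLp g (ENNReal.ofReal p))
    (hJ : ∫ t in Ioi (0 : ℝ), t ^ l * (1 + t ^ l) ^ (-(q / l)) <
      ∫ x in a..b, (∫ t in 0..x, g t) ^ q * x ^ (l - q)) :
    ∫ t in Ioi (0 : ℝ), (1 + t ^ l) ^ (-(q / l)) ≤ ∫ x, g x ^ p := by
  have hp0 : 0 < p := by linarith
  have hql : 1 < q - l := by rw [hq]; nlinarith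
  have hc : 0 < 1 - 1 / p := by rw [sub_pos, div_lt_one hp0]; exact hp
  have hloc := hg.locallyIntegrable (by simpa using hp.le)
  have hgi : ∀ u v, IntervalIntegrable g volume u v := fun u v ↦
    (hloc.integrableOn_isCompact isCompact_uIcc).intervalIntegrable
  have hgp : Integrable (fun x ↦ g x ^ p) := by
    have := hg.integrable_norm_rpow (by simpa using hp0) (by simp)
    simpa [ENNReal.toReal_ofReal hp0.le, abs_of_nonneg (hg0 _)] using this
  have hgpi : ∀ u v, IntervalIntegrable (fun x ↦ g x ^ p) volume u v := fun u v ↦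
    hgp.intervalIntegrable
  set G : ℝ → ℝ := fun x ↦ ∫ t in 0..x, g t with hG
  set W : ℝ → ℝ := fun t ↦ t ^ l * (1 + t ^ l) ^ (-(q / l)) with hW
  set K : ℝ → ℝ := fun t ↦ (1 + t ^ l) ^ (-(q / l)) with hK
  set Q : ℝ → ℝ := fun x ↦ ∫ t in 0..x, g t ^ p with hQ
  set P := ∫ x, g x ^ p with hP
  have hWi : IntegrableOn W (Ioi 0) := integrableOn_rpow_mul_one_add_rpow hl hql
  have hKi : IntegrableOn K (Ioi 0) := integrableOn_one_add_rpow hl (by linarith)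
  have hW0 : ∀ t, 0 < t → 0 ≤ W t := fun t ht ↦ by positivity
  have hGc : Continuous G := intervalIntegral.continuous_primitive hgi 0
  have hQc : Continuous Q := intervalIntegral.continuous_primitive hgpi 0
  have hG0 : ∀ x, 0 ≤ G x := fun x ↦ by
    rcases le_total 0 x with hx | hx
    · exact intervalIntegral.integral_nonneg hx fun t _ ↦ hg0 t
    · simp only [hG]
      rw [intervalIntegral.integral_symm, intervalIntegral.integral_of_le hx,
        setIntegral_congr_fun measurableSet_Ioc fun t ht ↦ hg' t ht.2]
      simp
  have hFc : ContinuousOn (fun x ↦ G x ^ q * x ^ (l - q)) (Ioi 0) :=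
    (hGc.continuousOn.rpow_const fun _ _ ↦ Or.inr (by nlinarith)).mul (continuousOn_rpow_Ioi _)
  have hFi : ∀ u v, 0 < u → u ≤ v →
      IntervalIntegrable (fun x ↦ G x ^ q * x ^ (l - q)) volume u v := fun u v hu huv ↦ by
    refine ContinuousOn.intervalIntegrable (hFc.mono ?_)
    rw [uIcc_of_le huv]
    exact fun x hx ↦ hu.trans_le hx.1
  have hF0 : ∀ x, 0 < x → 0 ≤ G x ^ q * x ^ (l - q) := fun x hx ↦
    mul_nonneg (Real.rpow_nonneg (hG0 x) _) (Real.rpow_nonneg hx.le _)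
  have hWK : ∀ t, 0 < t → W t * t ^ (-l) = K t := fun t ht ↦ by
    simp only [hW, hK]
    rw [mul_right_comm, ← Real.rpow_add ht, add_neg_cancel, Real.rpow_zero, one_mul]
  have key : ∀ e ∈ Ioo (0 : ℝ) 1, q * (1 - 1 / p) * ((∫ t in e..e⁻¹, W t) + ∫ t in e..e⁻¹, K t) ≤
      (q - l) * (P / p + (1 - 1 / p) * ∫ t in e..e⁻¹, K t) := by
    intro e he
    have he1 : e ≤ e⁻¹ := by
      have := (one_lt_inv₀ he.1).2 he.2
      linarith [he.2]
    have hWe0 : 0 ≤ ∫ t in e..e⁻¹, W t :=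
      intervalIntegral.integral_nonneg he1 fun t ht ↦ hW0 t (he.1.trans_le ht.1)
    have hWe : ∫ t in e..e⁻¹, W t ≤ ∫ t in Ioi 0, W t := by
      rw [intervalIntegral.integral_of_le he1]
      refine setIntegral_mono_set hWi ?_ ?_
      · filter_upwards [ae_restrict_mem measurableSet_Ioi] with t ht using hW0 t ht
      · exact (Ioc_subset_Ioi_self.trans (Ioi_subset_Ioi he.1.le)).eventuallyLE
    have hKe : ∫ t in e..e⁻¹, W t * t ^ (-l) = ∫ t in e..e⁻¹, K t := by
      refine intervalIntegral.integral_congr fun t ht ↦ hWK t ?_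
      rw [uIcc_of_le he1] at ht
      exact he.1.trans_le ht.1
    have step : ∀ s ∈ Ioc 0 a, q * (1 - 1 / p) * ((∫ t in e..e⁻¹, W t) + ∫ t in e..e⁻¹, K t) ≤
        (q - l) * (P / p + (1 - 1 / p) * ∫ t in e..e⁻¹, K t) +
          Q s ^ (1 / p * (q - l)) * e ^ (-(l * (1 - 1 / p))) := by
      intro s hs
      have hsb := hs.2.trans hab
      obtain ⟨b', hb', hmass⟩ := intermediate_value_Icc hsb
        (f := fun y ↦ ∫ x in s..y, G x ^ q * x ^ (l - q)) (by
          have := intervalIntegral.continuousOn_primitive_interval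
            (((hFi s b hs.1 hsb).1).congr_set_ae (s := Icc s b) Ioc_ae_eq_Icc.symm |>.mono_set
              (uIcc_of_le hsb).subset)
          rwa [uIcc_of_le hsb] at this)
        (show (∫ t in e..e⁻¹, W t) ∈ _ by
          refine ⟨by simpa using hWe0, hWe.trans (hJ.le.trans ?_)⟩
          refine intervalIntegral.integral_mono_interval hs.2 hab le_rfl ?_ (hFi s b hs.1 hsb)
          filter_upwards [ae_restrict_mem measurableSet_Ioc] with x hx
          exact hF0 x (hs.1.trans hx.1))
      have h := bliss_transport hp hl hq hs.1 hb'.1 he.1 he1 hGc hG0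
        (((hgi 0 b').absolutelyContinuousOnInterval_intervalIntegral left_mem_uIcc).mono
          (uIcc_subset_uIcc (mem_uIcc_of_le hs.1.le hb'.1) right_mem_uIcc)) hg0
        (by filter_upwards [LocallyIntegrable.ae_hasDerivAt_integral hloc] with x hx _ using hx 0)
        (hgpi s b') hmass
      rw [hKe] at h
      refine h.trans (add_le_add ?_ ?_)
      · gcongr
        · rw [intervalIntegral.integral_of_le hb'.1]
          exact setIntegral_le_integral hgp (ae_of_all _ fun x ↦ Real.rpow_nonneg (hg0 x) _)
      · rw [← mul_assoc]
        refine mul_le_mul_of_nonneg_right ?_ (Real.rpow_nonneg he.1.le _)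
        have hQ0 : 0 ≤ Q s := intervalIntegral.integral_nonneg hs.1.le
          fun t _ ↦ Real.rpow_nonneg (hg0 t) _
        have := Real.rpow_le_rpow (hG0 s)
          (intervalIntegral_le_rpow_mul_rpow hp hs.1.le hg0 hg) (show 0 ≤ q - l by linarith)
        rw [Real.mul_rpow (Real.rpow_nonneg hQ0 _) (Real.rpow_nonneg hs.1.le _),
          ← Real.rpow_mul hQ0, ← Real.rpow_mul hs.1.le] at this
        calc _ ≤ _ := mul_le_mul_of_nonneg_right this (Real.rpow_nonneg hs.1.le _)
          _ = _ := by
            rw [mul_assoc, ← Real.rpow_add hs.1, mul_comm (1 - 1 / p), add_neg_cancel,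
              Real.rpow_zero, mul_one]
    have hlim : Filter.Tendsto (fun s ↦ (q - l) * (P / p + (1 - 1 / p) * ∫ t in e..e⁻¹, K t) +
          Q s ^ (1 / p * (q - l)) * e ^ (-(l * (1 - 1 / p)))) (nhdsWithin 0 (Ioi 0))
          (nhds ((q - l) * (P / p + (1 - 1 / p) * ∫ t in e..e⁻¹, K t) + 0)) := by
      have hpos : 0 < 1 / p * (q - l) := mul_pos (by positivity) (by linarith)
      have hc : Continuous fun s ↦ Q s ^ (1 / p * (q - l)) :=
        hQc.rpow_const fun _ ↦ Or.inr hpos.le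
      have := (hc.tendsto 0).mono_left (nhdsWithin_le_nhds (s := Ioi 0))
      simp only [hQ, intervalIntegral.integral_same, Real.zero_rpow hpos.ne'] at this
      simpa only [zero_mul] using (this.mul_const (e ^ (-(l * (1 - 1 / p))))).const_add _
    rw [add_zero] at hlim
    exact ge_of_tendsto hlim (Filter.mem_of_superset (Ioc_mem_nhdsGT ha) step)
  have hIJ : (∫ t in Ioi 0, K t) = (q - l - 1) * ∫ t in Ioi 0, W t :=
    integral_one_add_rpow_eq hl hql
  have hl1 := tendsto_intervalIntegral_Ioi hWi
  have hl2 := tendsto_intervalIntegral_Ioi hKi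
  have hfin := le_of_tendsto_of_tendsto ((hl1.add hl2).const_mul (q * (1 - 1 / p)))
    (((hl2.const_mul (1 - 1 / p)).const_add (P / p)).const_mul (q - l))
    (Filter.mem_of_superset (Ioo_mem_nhdsGT one_pos) key)
  have e1 : q * (1 - 1 / p) = q - l - 1 := by rw [hq]; field_simp; ring
  have e2 : (q - l) * (1 - 1 / p) = (q - l - 1) + 1 - (q - l) / p := by
    field_simp; rw [hq]; ring
  rw [mul_add, e1, ← hIJ, mul_add, ← mul_assoc, e2, mul_div_left_comm] at hfin
  have e3 : 0 < (q - l) / p := div_pos (by linarith) hp0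
  refine le_of_mul_le_mul_left ?_ e3
  linarith

lemma lintegral_primitive_le_of_lt {p l q : ℝ} (hp : 1 < p) (hl : 0 < l) (hq : q = p * (1 + l))
    {g : ℝ → ℝ≥0∞} (hg : Measurable g)
    (hP : ∫⁻ x in Ioi 0, g x ^ p < ENNReal.ofReal (∫ t in Ioi (0 : ℝ), (1 + t ^ l) ^ (-(q / l)))) :
    ∫⁻ x in Ioi 0, (∫⁻ t in Ioo 0 x, g t) ^ q * ENNReal.ofReal (x ^ (l - q)) ≤
      ENNReal.ofReal (∫ t in Ioi (0 : ℝ), t ^ l * (1 + t ^ l) ^ (-(q / l))) := by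
  have hp0 : 0 < p := by linarith
  have hq0 : 0 < q := by rw [hq]; positivity
  have hJ : 0 ≤ ∫ t in Ioi (0 : ℝ), t ^ l * (1 + t ^ l) ^ (-(q / l)) :=
    setIntegral_nonneg measurableSet_Ioi fun t ht ↦ by
      have : (0 : ℝ) < t := ht
      positivity
  set J := ∫ t in Ioi (0 : ℝ), t ^ l * (1 + t ^ l) ^ (-(q / l)) with hJd
  by_contra! hcon
  set h : ℝ → ℝ≥0∞ := (Ioi 0).indicator g with hh
  set r : ℝ → ℝ := fun x ↦ (h x).toReal with hr
  have hm : Measurable h := hg.indicator measurableSet_Ioi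
  have hhp : (fun x ↦ h x ^ p) = (Ioi 0).indicator (fun x ↦ g x ^ p) := by
    ext x
    by_cases hx : x ∈ Ioi (0 : ℝ) <;> simp [hh, hx, hp0]
  have hPh : ∫⁻ x, h x ^ p = ∫⁻ x in Ioi 0, g x ^ p := by
    rw [hhp, lintegral_indicator measurableSet_Ioi]
  have hfin : ∀ᵐ x, ENNReal.ofReal (r x) = h x := by
    filter_upwards [ae_lt_top (hm.pow_const p) (hPh ▸ (hP.trans ENNReal.ofReal_lt_top).ne)]
      with x hx
    refine ENNReal.ofReal_toReal fun hx' ↦ ?_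
    simp [hx', ENNReal.top_rpow_of_pos hp0] at hx
  have hr0 : ∀ x, 0 ≤ r x := fun x ↦ ENNReal.toReal_nonneg
  have hrn : ∀ x ≤ 0, r x = 0 := fun x hx ↦ by simp [hr, hh, hx]
  have hrp : ∫⁻ x, ENNReal.ofReal (r x ^ p) = ∫⁻ x in Ioi 0, g x ^ p := by
    rw [← hPh]
    refine lintegral_congr_ae ?_
    filter_upwards [hfin] with x hx
    rw [← ENNReal.ofReal_rpow_of_nonneg (hr0 x) hp0.le, hx]
  have hrL : MemLp r (ENNReal.ofReal p) := by
    refine ⟨hm.ennreal_toReal.aestronglyMeasurable, ?_⟩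
    rw [eLpNorm_lt_top_iff_lintegral_rpow_enorm_lt_top (by simpa using hp0) (by simp),
      ENNReal.toReal_ofReal hp0.le]
    refine lt_of_eq_of_lt (lintegral_congr fun x ↦ ?_)
      (hrp.trans_lt (hP.trans ENNReal.ofReal_lt_top))
    rw [Real.enorm_of_nonneg (hr0 x), ENNReal.ofReal_rpow_of_nonneg (hr0 x) hp0.le]
  have hloc := hrL.locallyIntegrable (by simpa using hp.le)
  have hri : ∀ u v, IntervalIntegrable r volume u v := fun u v ↦
    (hloc.integrableOn_isCompact isCompact_uIcc).intervalIntegrable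
  have hprim : ∀ x, 0 < x → ∫⁻ t in Ioo 0 x, g t = ENNReal.ofReal (∫ t in 0..x, r t) := by
    intro x hx
    rw [intervalIntegral.integral_of_le hx.le, ofReal_integral_eq_lintegral_ofReal (hri 0 x).1
      (ae_of_all _ hr0), ← setLIntegral_congr Ioo_ae_eq_Ioc,
      lintegral_congr_ae (ae_restrict_of_ae hfin)]
    refine setLIntegral_congr_fun measurableSet_Ioo fun t ht ↦ ?_
    simp [hh, ht.1]
  set F : ℝ → ℝ := fun x ↦ (∫ t in 0..x, r t) ^ q * x ^ (l - q) with hF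
  have hF0 : ∀ x, 0 < x → 0 ≤ F x := fun x hx ↦
    mul_nonneg (Real.rpow_nonneg (intervalIntegral.integral_nonneg hx.le fun t _ ↦ hr0 t) _)
      (Real.rpow_nonneg hx.le _)
  have hFc : ContinuousOn F (Ioi 0) :=
    ((intervalIntegral.continuous_primitive hri 0).continuousOn.rpow_const
      fun _ _ ↦ Or.inr hq0.le).mul (continuousOn_rpow_Ioi _)
  have hFL : ∫⁻ x in Ioi 0, (∫⁻ t in Ioo 0 x, g t) ^ q * ENNReal.ofReal (x ^ (l - q)) =
      ∫⁻ x in Ioi 0, ENNReal.ofReal (F x) := by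
    refine setLIntegral_congr_fun measurableSet_Ioi fun x hx ↦ ?_
    have hG : 0 ≤ ∫ t in 0..x, r t :=
      intervalIntegral.integral_nonneg (le_of_lt hx) fun t _ ↦ hr0 t
    simp only [hF]
    rw [hprim x hx, ENNReal.ofReal_mul (Real.rpow_nonneg hG _),
      ENNReal.ofReal_rpow_of_nonneg hG hq0.le]
  have hU : (⋃ n : ℕ, Ioc (1 / ((n : ℝ) + 1)) (n + 1)) = Ioi 0 := by
    ext x
    simp only [mem_iUnion, mem_Ioc, mem_Ioi]
    refine ⟨fun ⟨n, hn, _⟩ ↦ lt_trans (by positivity) hn, fun hx ↦ ?_⟩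
    obtain ⟨n, hn⟩ := exists_nat_one_div_lt hx
    obtain ⟨k, hk⟩ := exists_nat_ge x
    refine ⟨max n k, lt_of_le_of_lt (one_div_le_one_div_of_le (by positivity) ?_) hn, ?_⟩
    · gcongr; exact le_max_left _ _
    · have : (k : ℝ) ≤ (max n k : ℕ) := by gcongr; exact le_max_right _ _
      linarith
  rw [hFL, ← hU, setLIntegral_iUnion_of_directed _ (directed_of_isDirected_le fun m n hmn ↦
    Ioc_subset_Ioc (by gcongr) (by gcongr)), lt_iSup_iff] at hcon
  obtain ⟨n, hn⟩ := hcon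
  have hn0 : 0 < 1 / ((n : ℝ) + 1) := by positivity
  have hn1 : 1 / ((n : ℝ) + 1) ≤ n + 1 := by
    have : (0 : ℝ) ≤ n := n.cast_nonneg
    rw [div_le_iff₀ (by positivity)]; nlinarith
  have hFi : IntegrableOn F (Ioc (1 / ((n : ℝ) + 1)) (n + 1)) :=
    ((hFc.mono fun x hx ↦ hn0.trans_le hx.1).integrableOn_Icc).mono_set Ioc_subset_Icc_self
  rw [← ofReal_integral_eq_lintegral_ofReal hFi (by
      filter_upwards [ae_restrict_mem measurableSet_Ioc] with x hx using hF0 x (hn0.trans hx.1)),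
    ← intervalIntegral.integral_of_le hn1, ENNReal.ofReal_lt_ofReal_iff_of_nonneg hJ] at hn
  have hb := bliss_contrapositive hp hl hq hn0 hn1 hr0 hrn hrL hn
  refine absurd hP (not_lt.2 ((ENNReal.ofReal_le_ofReal hb).trans_eq ?_))
  rw [← hrp, ofReal_integral_eq_lintegral_ofReal ?_ (ae_of_all _ fun x ↦
    Real.rpow_nonneg (hr0 x) _)]
  have := hrL.integrable_norm_rpow (by simpa using hp0) (by simp)
  simpa [ENNReal.toReal_ofReal hp0.le, abs_of_nonneg (hr0 _)] using this

lemma integral_one_add_rpow_pos {l q : ℝ} (hl : 0 < l) (hq : 1 < q) :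
    0 < ∫ t in Ioi (0 : ℝ), (1 + t ^ l) ^ (-(q / l)) := by
  have h0 : ∀ t : ℝ, 0 < t → 0 < (1 + t ^ l) ^ (-(q / l)) := fun t ht ↦ by positivity
  rw [setIntegral_pos_iff_support_of_nonneg_ae
    (by filter_upwards [ae_restrict_mem measurableSet_Ioi] with t ht using (h0 t ht).le)
    (integrableOn_one_add_rpow hl hq), inter_eq_self_of_subset_right (show Ioi (0 : ℝ) ⊆
      Function.support _ from fun t ht ↦ (h0 t ht).ne')]
  simp

lemma bliss_lintegral {p l q : ℝ} (hp : 1 < p) (hl : 0 < l) (hq : q = p * (1 + l))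
    {g : ℝ → ℝ≥0∞} (hg : Measurable g) :
    ∫⁻ x in Ioi 0, (∫⁻ t in Ioo 0 x, g t) ^ q * ENNReal.ofReal (x ^ (l - q)) ≤
      ENNReal.ofReal (∫ t in Ioi (0 : ℝ), t ^ l * (1 + t ^ l) ^ (-(q / l))) *
        ENNReal.ofReal (∫ t in Ioi (0 : ℝ), (1 + t ^ l) ^ (-(q / l))) ^ (-(q / p)) *
        (∫⁻ x in Ioi 0, g x ^ p) ^ (q / p) := by
  set I := ∫ t in Ioi (0 : ℝ), (1 + t ^ l) ^ (-(q / l)) with hI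
  set J := ∫ t in Ioi (0 : ℝ), t ^ l * (1 + t ^ l) ^ (-(q / l)) with hJ
  set P := ∫⁻ x in Ioi 0, g x ^ p with hP
  have hp0 : 0 < p := by linarith
  have hql : 1 < q - l := by rw [hq]; nlinarith
  have hq0 : 0 < q := by linarith
  have hI0 : 0 < I := integral_one_add_rpow_pos hl (by linarith)
  have hIJ : I = (q - l - 1) * J := integral_one_add_rpow_eq hl hql
  have hJ0 : 0 < J := by
    refine pos_of_mul_pos_right (a := q - l - 1) (hIJ ▸ hI0) (by linarith)
  have hI' : ENNReal.ofReal I ≠ 0 := by simpa using hI0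
  have hJ' : ENNReal.ofReal J ≠ 0 := by simpa using hJ0
  have hA : ENNReal.ofReal J * ENNReal.ofReal I ^ (-(q / p)) ≠ ⊤ :=
    ENNReal.mul_ne_top ENNReal.ofReal_ne_top
      (ENNReal.rpow_ne_top_of_ne_zero hI' ENNReal.ofReal_ne_top)
  rcases eq_or_ne P ⊤ with hPt | hPt
  · rw [hPt, ENNReal.top_rpow_of_pos (by positivity), ENNReal.mul_top]
    · exact le_top
    · refine mul_ne_zero hJ' fun h ↦ ?_
      simp [ENNReal.rpow_eq_zero_iff, hI0.not_ge] at h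
  have hlim : Filter.Tendsto (fun Y : ℝ≥0∞ ↦
      ENNReal.ofReal J * ENNReal.ofReal I ^ (-(q / p)) * Y ^ (q / p)) (nhdsWithin P (Ioi P))
      (nhds (ENNReal.ofReal J * ENNReal.ofReal I ^ (-(q / p)) * P ^ (q / p))) :=
    ENNReal.Tendsto.const_mul ((ENNReal.continuous_rpow_const.tendsto P).mono_left
      nhdsWithin_le_nhds) (Or.inr hA)
  have : (nhdsWithin P (Ioi P)).NeBot := nhdsGT_neBot_of_exists_gt ⟨⊤, hPt.lt_top⟩
  refine ge_of_tendsto hlim (Filter.mem_of_superset (Ioo_mem_nhdsGT hPt.lt_top) fun Y hY ↦ ?_)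
  have hY0 : Y ≠ 0 := (bot_lt_of_lt hY.1).ne'
  have hYt : Y ≠ ⊤ := hY.2.ne
  set c : ℝ≥0∞ := (ENNReal.ofReal I / Y) ^ (1 / p) with hc
  have hcp : c ^ p = ENNReal.ofReal I / Y := by
    rw [hc, ← ENNReal.rpow_mul, one_div_mul_cancel hp0.ne', ENNReal.rpow_one]
  have hd0 : ENNReal.ofReal I / Y ≠ 0 := (ENNReal.div_pos hI' hYt).ne'
  have hdt : ENNReal.ofReal I / Y ≠ ⊤ := ENNReal.div_ne_top ENNReal.ofReal_ne_top hY0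
  have hcq : c ^ q = (ENNReal.ofReal I / Y) ^ (q / p) := by
    rw [hc, ← ENNReal.rpow_mul, one_div_mul_eq_div]
  have h := lintegral_primitive_le_of_lt hp hl hq (g := fun x ↦ c * g x) (hg.const_mul c) (by
    simp only [ENNReal.mul_rpow_of_nonneg _ _ hp0.le]
    rw [lintegral_const_mul _ (hg.pow_const p), hcp, ← hI, ← hP, ENNReal.div_eq_inv_mul, mul_assoc,
      mul_left_comm]
    refine (ENNReal.mul_lt_mul_right hI' ENNReal.ofReal_ne_top ?_).trans_eq (mul_one _)
    rw [← ENNReal.div_eq_inv_mul, ENNReal.div_lt_iff (Or.inl hY0) (Or.inl hYt), one_mul]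
    exact hY.1)
  have hmul : ∀ x, (∫⁻ t in Ioo 0 x, c * g t) ^ q * ENNReal.ofReal (x ^ (l - q)) =
      c ^ q * ((∫⁻ t in Ioo 0 x, g t) ^ q * ENNReal.ofReal (x ^ (l - q))) := fun x ↦ by
    rw [lintegral_const_mul _ hg, ENNReal.mul_rpow_of_nonneg _ _ hq0.le, mul_assoc]
  simp only [hmul] at h
  have hcq0 : c ^ q ≠ 0 := by
    rw [hcq]; simp [ENNReal.rpow_eq_zero_iff, hd0, hdt]
  have hcqt : c ^ q ≠ ⊤ := hcq ▸ ENNReal.rpow_ne_top_of_nonneg (by positivity) hdt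
  rw [lintegral_const_mul' _ _ hcqt, mul_comm (c ^ q),
    ← ENNReal.le_div_iff_mul_le (Or.inl hcq0) (Or.inl hcqt)] at h
  refine h.trans_eq ?_
  rw [hcq, ENNReal.div_eq_inv_mul, ← ENNReal.rpow_neg, ENNReal.rpow_neg,
    ← ENNReal.inv_rpow, ENNReal.inv_div (Or.inl hYt) (Or.inl hY0),
    ENNReal.div_rpow_of_nonneg _ _ (by positivity), ENNReal.rpow_neg, ENNReal.div_eq_inv_mul]
  ring

lemma lintegral_one_add_rpow_Ioo {l x : ℝ} (hl : 0 < l) (hx : 0 < x) :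
    ∫⁻ t in Ioo 0 x, ENNReal.ofReal ((1 + t ^ l) ^ (-((1 + l) / l))) =
      ENNReal.ofReal (x * (1 + x ^ l) ^ (-(1 / l))) := by
  have hpos : ∀ t : ℝ, 0 ≤ t → 0 < 1 + t ^ l := fun t ht ↦ by positivity
  have hc : ContinuousOn (fun t : ℝ ↦ (1 + t ^ l) ^ (-((1 + l) / l))) (Icc 0 x) := fun t ht ↦
    ((continuousAt_const.add (Real.continuousAt_rpow_const _ _ (Or.inr hl.le))).rpow_const
      (Or.inl (hpos t ht.1).ne')).continuousWithinAt
  have hi : IntervalIntegrable (fun t : ℝ ↦ (1 + t ^ l) ^ (-((1 + l) / l))) volume 0 x :=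
    ContinuousOn.intervalIntegrable (by rwa [uIcc_of_le hx.le])
  have h := intervalIntegral.integral_eq_sub_of_hasDerivAt_of_le (a := 0) (b := x)
    (f := fun t ↦ t * (1 + t ^ l) ^ (-(1 / l))) hx.le ?_ ?_ hi
  · rw [setLIntegral_congr Ioo_ae_eq_Ioc, ← ofReal_integral_eq_lintegral_ofReal hi.1,
      ← intervalIntegral.integral_of_le hx.le, h, zero_mul, sub_zero]
    filter_upwards [ae_restrict_mem measurableSet_Ioc] with t ht
      using Real.rpow_nonneg (hpos t ht.1.le).le _
  · exact fun t ht ↦ (continuousAt_id.mul ((continuousAt_const.add (Real.continuousAt_rpow_const _ _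
      (Or.inr hl.le))).rpow_const (Or.inl (hpos t ht.1).ne'))).continuousWithinAt
  · intro t ht
    have ht : 0 < t := ht.1
    have h1 := hpos t ht.le
    refine ((hasDerivAt_id t).mul (((Real.hasDerivAt_rpow_const (p := l)
      (Or.inl ht.ne')).const_add 1).rpow_const (p := -(1 / l)) (Or.inl h1.ne'))).congr_deriv ?_
    have e1 : (1 + t ^ l) ^ (-(1 / l)) = (1 + t ^ l) ^ (-((1 + l) / l)) * (1 + t ^ l) := by
      nth_rw 3 [← Real.rpow_one (1 + t ^ l)]
      rw [← Real.rpow_add h1]; congr 1; field_simp; ring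
    have e2 : -(1 / l) - 1 = -((1 + l) / l) := by field_simp; ring
    have e3 : t ^ l = t * t ^ (l - 1) := by
      rw [Real.rpow_sub_one ht.ne']; field_simp
    rw [e1, e2, e3, id]
    field_simp
    ring

lemma lintegral_one_add_rpow_rpow {p l q : ℝ} (hp : 1 < p) (hl : 0 < l) (hq : q = p * (1 + l)) :
    ∫⁻ x in Ioi 0, ENNReal.ofReal ((1 + x ^ l) ^ (-((1 + l) / l))) ^ p =
      ENNReal.ofReal (∫ t in Ioi (0 : ℝ), (1 + t ^ l) ^ (-(q / l))) := by
  rw [ofReal_integral_eq_lintegral_ofReal (integrableOn_one_add_rpow hl (by rw [hq]; nlinarith))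
    (by filter_upwards [ae_restrict_mem measurableSet_Ioi] with t (ht : 0 < t)
        positivity)]
  refine setLIntegral_congr_fun measurableSet_Ioi fun x (hx : 0 < x) ↦ ?_
  rw [ENNReal.ofReal_rpow_of_nonneg (by positivity) (by linarith), ← Real.rpow_mul (by positivity),
    hq]
  congr 2
  ring

lemma lintegral_one_add_rpow_primitive {p l q : ℝ} (hp : 1 < p) (hl : 0 < l)
    (hq : q = p * (1 + l)) :
    ∫⁻ x in Ioi 0, (∫⁻ t in Ioo 0 x, ENNReal.ofReal ((1 + t ^ l) ^ (-((1 + l) / l)))) ^ q *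
        ENNReal.ofReal (x ^ (l - q)) =
      ENNReal.ofReal (∫ t in Ioi (0 : ℝ), t ^ l * (1 + t ^ l) ^ (-(q / l))) := by
  have hql : 1 < q - l := by rw [hq]; nlinarith
  rw [ofReal_integral_eq_lintegral_ofReal (integrableOn_rpow_mul_one_add_rpow hl hql)
    (by filter_upwards [ae_restrict_mem measurableSet_Ioi] with t (ht : 0 < t)
        positivity)]
  refine setLIntegral_congr_fun measurableSet_Ioi fun x (hx : 0 < x) ↦ ?_
  rw [lintegral_one_add_rpow_Ioo hl hx, ENNReal.ofReal_rpow_of_nonneg (by positivity) (by linarith),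
    ← ENNReal.ofReal_mul (by positivity), Real.mul_rpow hx.le (by positivity),
    ← Real.rpow_mul (by positivity), Real.rpow_sub hx]
  congr 1
  rw [show -(1 / l) * q = -(q / l) by ring]
  field_simp

lemma measurable_lintegral_sphere {E : Type*} [NormedAddCommGroup E] [NormedSpace ℝ E]
    [MeasurableSpace E] [BorelSpace E] [FiniteDimensional ℝ E] (μ : Measure E)
    [μ.IsAddHaarMeasure] {f : E → ℝ≥0∞} (hf : Measurable f) :
    Measurable fun r : ℝ ↦ ∫⁻ θ, f (r • θ) ∂μ.toSphere := by
  refine Measurable.lintegral_prod_right' (f := fun z : ℝ × Metric.sphere (0 : E) 1 ↦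
    f (z.1 • z.2)) ?_
  fun_prop

lemma lintegral_polar {E : Type*} [NormedAddCommGroup E] [NormedSpace ℝ E] [MeasurableSpace E]
    [BorelSpace E] [FiniteDimensional ℝ E] [Nontrivial E] (μ : Measure E) [μ.IsAddHaarMeasure]
    {f : E → ℝ≥0∞} (hf : Measurable f) :
    ∫⁻ x, f x ∂μ = ∫⁻ r in Ioi (0 : ℝ), ENNReal.ofReal (r ^ (Module.finrank ℝ E - 1)) *
      ∫⁻ θ, f (r • θ) ∂μ.toSphere := by
  have hms : MeasurableSet ({0}ᶜ : Set E) := (measurableSet_singleton 0).compl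
  have hpow : Measurable fun r : Ioi (0 : ℝ) ↦
      ENNReal.ofReal ((r : ℝ) ^ (Module.finrank ℝ E - 1)) := by fun_prop
  have hmf : Measurable fun z : Metric.sphere (0 : E) 1 × Ioi (0 : ℝ) ↦
      f ((z.2 : ℝ) • (z.1 : E)) := by fun_prop
  calc ∫⁻ x, f x ∂μ = ∫⁻ x in ({0}ᶜ : Set E), f x ∂μ := by
        rw [restrict_compl_singleton]
    _ = ∫⁻ x : ({0}ᶜ : Set E), f x ∂μ.comap (↑) := (lintegral_subtype_comap hms f).symm
    _ = ∫⁻ z, f ((z.2 : ℝ) • (z.1 : E))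
          ∂(μ.toSphere.prod (Measure.volumeIoiPow (Module.finrank ℝ E - 1))) := by
        rw [← (Measure.measurePreserving_homeomorphUnitSphereProd μ).lintegral_comp hmf]
        refine lintegral_congr fun x ↦ ?_
        congr 1
        have := congrArg Subtype.val ((homeomorphUnitSphereProd E).symm_apply_apply x)
        rw [homeomorphUnitSphereProd_symm_apply_coe] at this
        exact this.symm
    _ = _ := by
        rw [lintegral_prod_symm' _ hmf, Measure.volumeIoiPow]
        refine (lintegral_withDensity_eq_lintegral_mul _ hpow
          ((measurable_lintegral_sphere μ hf).comp measurable_subtype_coe)).trans ?_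
        exact lintegral_subtype_comap measurableSet_Ioi fun r ↦
          ENNReal.ofReal (r ^ (Module.finrank ℝ E - 1)) * ∫⁻ θ, f (r • θ) ∂μ.toSphere

lemma lintegral_polar_rpow {E : Type*} [NormedAddCommGroup E] [NormedSpace ℝ E]
    [MeasurableSpace E] [BorelSpace E] [FiniteDimensional ℝ E] [Nontrivial E] (μ : Measure E)
    [μ.IsAddHaarMeasure] {f : E → ℝ≥0∞} (hf : Measurable f) {a : ℝ} (ha : 0 < a) :
    ∫⁻ x, f x ∂μ = ∫⁻ u in Ioi (0 : ℝ),
      ENNReal.ofReal (1 / a * u ^ (Module.finrank ℝ E / a - 1)) *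
        ∫⁻ θ, f (u ^ (1 / a) • θ) ∂μ.toSphere := by
  have hd : (1 : ℕ) ≤ Module.finrank ℝ E := Module.finrank_pos
  have himg : (fun u : ℝ ↦ u ^ (1 / a)) '' Ioi 0 = Ioi 0 := by
    ext r
    refine ⟨?_, fun hr ↦ ⟨r ^ a, Real.rpow_pos_of_pos hr a, ?_⟩⟩
    · rintro ⟨u, hu, rfl⟩
      exact Real.rpow_pos_of_pos hu _
    · simp only
      rw [← Real.rpow_mul (le_of_lt hr), mul_one_div_cancel ha.ne', Real.rpow_one]
  rw [lintegral_polar μ hf, ← himg, lintegral_image_eq_lintegral_abs_deriv_mul measurableSet_Ioi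
    (fun u hu ↦ (Real.hasDerivAt_rpow_const (Or.inl (ne_of_gt hu))).hasDerivWithinAt)
    (fun u hu v hv h ↦ (Real.rpow_left_inj (le_of_lt hu) (le_of_lt hv) (by positivity)).1 h), himg]
  refine setLIntegral_congr_fun measurableSet_Ioi fun u (hu : 0 < u) ↦ ?_
  rw [← mul_assoc, ← ENNReal.ofReal_mul (abs_nonneg _), abs_of_nonneg (by positivity)]
  congr 2
  rw [← Real.rpow_natCast, ← Real.rpow_mul hu.le, mul_assoc, ← Real.rpow_add hu]
  push_cast [hd]
  congr 2
  field_simp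
  ring

lemma lintegral_ball_polar {E : Type*} [NormedAddCommGroup E] [NormedSpace ℝ E]
    [MeasurableSpace E] [BorelSpace E] [FiniteDimensional ℝ E] [Nontrivial E] (μ : Measure E)
    [μ.IsAddHaarMeasure] {f : E → ℝ≥0∞} (hf : Measurable f) {a u : ℝ} (ha : 0 < a) (hu : 0 < u) :
    ∫⁻ y in Metric.ball 0 (u ^ (1 / a)), f y ∂μ = ∫⁻ t in Ioo 0 u,
      ENNReal.ofReal (1 / a * t ^ (Module.finrank ℝ E / a - 1)) *
        ∫⁻ θ, f (t ^ (1 / a) • θ) ∂μ.toSphere := by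
  rw [← lintegral_indicator Metric.isOpen_ball.measurableSet,
    lintegral_polar_rpow μ (hf.indicator Metric.isOpen_ball.measurableSet) ha,
    ← lintegral_indicator measurableSet_Ioi, ← lintegral_indicator measurableSet_Ioo]
  refine lintegral_congr fun t ↦ ?_
  by_cases ht : 0 < t
  swap
  · rw [indicator_of_notMem (by simpa using ht), indicator_of_notMem (by simp [ht])]
  rw [indicator_of_mem (mem_Ioi.2 ht)]
  have hball : ∀ θ : Metric.sphere (0 : E) 1,
      t ^ (1 / a) • (θ : E) ∈ Metric.ball 0 (u ^ (1 / a)) ↔ t < u := fun θ ↦ by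
    rw [mem_ball_zero_iff, norm_smul, norm_eq_of_mem_sphere, mul_one,
      Real.norm_of_nonneg (by positivity), Real.rpow_lt_rpow_iff ht.le hu.le (by positivity)]
  by_cases htu : t < u
  · rw [indicator_of_mem (show t ∈ Ioo 0 u from ⟨ht, htu⟩)]
    congr 1
    exact lintegral_congr fun θ ↦ indicator_of_mem ((hball θ).2 htu) _
  · rw [indicator_of_notMem (by simp [htu])]
    simp only [indicator_of_notMem (mt (hball _).1 htu), lintegral_zero, mul_zero]

lemma measurable_lintegral_ball {E : Type*} [NormedAddCommGroup E] [MeasurableSpace E]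
    [BorelSpace E] [SecondCountableTopology E] (μ : Measure E) [SFinite μ] {f : E → ℝ≥0∞}
    (hf : Measurable f) : Measurable fun x : E ↦ ∫⁻ y in Metric.ball 0 ‖x‖, f y ∂μ := by
  have hs : MeasurableSet {z : E × E | ‖z.2‖ < ‖z.1‖} :=
    measurableSet_lt (by fun_prop) (by fun_prop)
  have h := Measurable.lintegral_prod_right' (ν := μ)
    ((hf.comp measurable_snd).indicator hs)
  convert h using 2 with x
  rw [← lintegral_indicator Metric.isOpen_ball.measurableSet]
  refine lintegral_congr fun y ↦ ?_
  simp [indicator]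

lemma lintegral_rpow_le_measure_univ_rpow_mul {X : Type*} [MeasurableSpace X] (μ : Measure X)
    {p : ℝ} (hp : 1 < p) {f : X → ℝ≥0∞} (hf : Measurable f) :
    (∫⁻ x, f x ∂μ) ^ p ≤ μ univ ^ (p - 1) * ∫⁻ x, f x ^ p ∂μ := by
  have hp0 : 0 < p := by linarith
  have h := ENNReal.lintegral_mul_le_Lp_mul_Lq μ (Real.HolderConjugate.conjExponent hp)
    hf.aemeasurable (g := fun _ ↦ 1) aemeasurable_const
  simp only [Pi.mul_apply, mul_one, ENNReal.one_rpow, lintegral_const, one_mul] at h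
  have h2 := ENNReal.rpow_le_rpow h hp0.le
  rw [ENNReal.mul_rpow_of_nonneg _ _ hp0.le, ← ENNReal.rpow_mul, ← ENNReal.rpow_mul,
    one_div_mul_cancel hp0.ne', ENNReal.rpow_one, mul_comm] at h2
  convert h2 using 3
  rw [Real.conjExponent]
  have : p - 1 ≠ 0 := by linarith
  field_simp

lemma norm_rpow_smul_sphere {E : Type*} [NormedAddCommGroup E] [NormedSpace ℝ E]
    {a t : ℝ} (ht : 0 < t) (θ : Metric.sphere (0 : E) 1) :
    ‖t ^ (1 / a) • (θ : E)‖ = t ^ (1 / a) := by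
  rw [norm_smul, norm_eq_of_mem_sphere, mul_one, Real.norm_of_nonneg (by positivity)]

/-- The extremal function of the weighted Hardy inequality, obtained from Bliss' extremal. -/
noncomputable def blissExtremal {E : Type*} [NormedAddCommGroup E] [NormedSpace ℝ E] (a l : ℝ)
    (x : E) : ℝ≥0∞ :=
  ENNReal.ofReal ((1 + (‖x‖ ^ a) ^ l) ^ (-((1 + l) / l)) * ‖x‖ ^ (a - Module.finrank ℝ E))

lemma measurable_blissExtremal {E : Type*} [NormedAddCommGroup E] [NormedSpace ℝ E]
    [MeasurableSpace E] [BorelSpace E] (a l : ℝ) :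
    Measurable (blissExtremal a l : E → ℝ≥0∞) := by
  unfold blissExtremal; fun_prop

lemma blissExtremal_smul_sphere {E : Type*} [NormedAddCommGroup E] [NormedSpace ℝ E] {a l t : ℝ}
    (ha : 0 < a) (ht : 0 < t) (θ : Metric.sphere (0 : E) 1) :
    blissExtremal a l (t ^ (1 / a) • (θ : E)) =
      ENNReal.ofReal ((1 + t ^ l) ^ (-((1 + l) / l)) * t ^ (1 - Module.finrank ℝ E / a)) := by
  have e : (t ^ (1 / a)) ^ a = t := by
    rw [← Real.rpow_mul ht.le, one_div_mul_cancel ha.ne', Real.rpow_one]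
  rw [blissExtremal, norm_rpow_smul_sphere ht, e, ← Real.rpow_mul ht.le]
  congr 3
  field_simp

section Radial

variable {E : Type*} [NormedAddCommGroup E] [NormedSpace ℝ E] [MeasurableSpace E]
  [BorelSpace E] [FiniteDimensional ℝ E] (μ : Measure E) [μ.IsAddHaarMeasure]

/-- The density on `(0, ∞)` of the image of `f μ` under `x ↦ ‖x‖ ^ a`. -/
noncomputable def radialDensity (a : ℝ) (f : E → ℝ≥0∞) (t : ℝ) : ℝ≥0∞ :=
  ENNReal.ofReal (1 / a * t ^ (Module.finrank ℝ E / a - 1)) *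
    ∫⁻ θ, f (t ^ (1 / a) • θ) ∂μ.toSphere

lemma measurable_radialDensity (a : ℝ) {f : E → ℝ≥0∞} (hf : Measurable f) :
    Measurable (radialDensity μ a f) := by
  have := (measurable_lintegral_sphere μ hf).comp (measurable_id.pow_const (1 / a))
  exact (by fun_prop : Measurable fun t : ℝ ↦
    ENNReal.ofReal (1 / a * t ^ (Module.finrank ℝ E / a - 1))).mul this

variable {μ}

lemma toSphere_univ_eq_ofReal {v : ℝ} (hv : μ (Metric.ball 0 1) = ENNReal.ofReal v) :
    μ.toSphere univ = ENNReal.ofReal (Module.finrank ℝ E * v) := by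
  rw [Measure.toSphere_apply_univ, hv, ENNReal.ofReal_mul (Nat.cast_nonneg _),
    ENNReal.ofReal_natCast]

variable [Nontrivial E]

lemma lintegral_hardy_eq {p q l a v α γ : ℝ} (hp : 1 < p) (hl : 0 < l) (hq : q = p * (1 + l))
    (ha : 0 < a) (hv : 0 < v) (hμ : μ (Metric.ball 0 1) = ENNReal.ofReal v)
    (hγ : γ = (Module.finrank ℝ E - a) * (p - 1))
    (hα : (α + Module.finrank ℝ E) / q = (γ + Module.finrank ℝ E) / p)
    {f : E → ℝ≥0∞} (hf : Measurable f) :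
    ∫⁻ x, ((μ (Metric.ball 0 ‖x‖))⁻¹ * ∫⁻ y in Metric.ball 0 ‖x‖, f y ∂μ) ^ q *
        ENNReal.ofReal (‖x‖ ^ α) ∂μ =
      ENNReal.ofReal (Module.finrank ℝ E * v / a * v ^ (-q)) *
        ∫⁻ u in Ioi 0, (∫⁻ t in Ioo 0 u, radialDensity μ a f t) ^ q *
          ENNReal.ofReal (u ^ (l - q)) := by
  have hd : (0 : ℝ) < Module.finrank ℝ E := Nat.cast_pos.2 Module.finrank_pos
  have hq0 : 0 < q := by rw [hq]; positivity
  have hb : Measurable fun x : E ↦ μ (Metric.ball 0 ‖x‖) := by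
    simpa using measurable_lintegral_ball μ (f := fun _ ↦ 1) measurable_const
  have hb' := measurable_lintegral_ball μ hf
  have hm : Measurable fun x : E ↦ ((μ (Metric.ball 0 ‖x‖))⁻¹ *
      ∫⁻ y in Metric.ball 0 ‖x‖, f y ∂μ) ^ q * ENNReal.ofReal (‖x‖ ^ α) :=
    ((hb.inv.mul hb').pow_const q).mul (by fun_prop)
  rw [lintegral_polar_rpow μ hm ha, ← lintegral_const_mul' _ _ ENNReal.ofReal_ne_top]
  refine setLIntegral_congr_fun measurableSet_Ioi fun u (hu : 0 < u) ↦ ?_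
  simp only [norm_rpow_smul_sphere hu, lintegral_const, lintegral_ball_polar μ hf ha hu,
    toSphere_univ_eq_ofReal hμ]
  rw [μ.addHaar_ball _ (by positivity), hμ, ← ENNReal.ofReal_mul (by positivity),
    ← ENNReal.ofReal_inv_of_pos (by positivity), ENNReal.mul_rpow_of_nonneg _ _ hq0.le,
    ENNReal.ofReal_rpow_of_nonneg (by positivity) hq0.le]
  change _ * (_ * (∫⁻ t in Ioo 0 u, radialDensity μ a f t) ^ q * _ * _) = _
  set G := (∫⁻ t in Ioo 0 u, radialDensity μ a f t) ^ q
  have hrw : ∀ A B C D F H : ℝ, 0 ≤ A → 0 ≤ B → 0 ≤ C → 0 ≤ D → 0 ≤ F → A * B * C * D = F * H →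
      ENNReal.ofReal A * (ENNReal.ofReal B * G * ENNReal.ofReal C * ENNReal.ofReal D) =
        ENNReal.ofReal F * (G * ENNReal.ofReal H) := by
    intro A B C D F H hA hB hC hD hF h
    rw [mul_left_comm (ENNReal.ofReal F), ← ENNReal.ofReal_mul hF, ← h, ENNReal.ofReal_mul
      (by positivity), ENNReal.ofReal_mul (by positivity), ENNReal.ofReal_mul (by positivity)]
    ring
  refine hrw _ _ _ _ _ _ (by positivity) (by positivity) (by positivity) (by positivity)
    (by positivity) ?_
  have e : ((Module.finrank ℝ E : ℝ) / a - 1) + -(Module.finrank ℝ E / a * q) + α / a = l - q := by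
    have : α = q * ((γ + Module.finrank ℝ E) / p) - Module.finrank ℝ E := by
      rw [← hα]; field_simp; ring
    rw [this, hγ, hq]
    field_simp
    ring
  rw [← e, Real.rpow_add hu, Real.rpow_add hu, mul_inv, Real.mul_rpow (by positivity) (by positivity),
    Real.inv_rpow (by positivity), Real.inv_rpow hv.le, ← Real.rpow_neg hv.le,
    ← Real.rpow_natCast, ← Real.rpow_mul hu.le, ← Real.rpow_mul hu.le, ← Real.rpow_mul hu.le,
    ← Real.rpow_neg hu.le, show 1 / a * α = α / a by ring,
    show 1 / a * (Module.finrank ℝ E : ℝ) = Module.finrank ℝ E / a by ring]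
  ring

lemma lintegral_radialDensity_rpow_le {p a v γ : ℝ} (hp : 1 < p) (ha : 0 < a) (hv : 0 < v)
    (hμ : μ (Metric.ball 0 1) = ENNReal.ofReal v)
    (hγ : γ = (Module.finrank ℝ E - a) * (p - 1)) {f : E → ℝ≥0∞} (hf : Measurable f) :
    ∫⁻ u in Ioi 0, radialDensity μ a f u ^ p ≤
      ENNReal.ofReal ((Module.finrank ℝ E * v / a) ^ (p - 1)) *
        ∫⁻ x, f x ^ p * ENNReal.ofReal (‖x‖ ^ γ) ∂μ := by
  have hp0 : 0 < p := by linarith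
  have hd : (0 : ℝ) < Module.finrank ℝ E := Nat.cast_pos.2 Module.finrank_pos
  rw [lintegral_polar_rpow μ (by fun_prop) ha,
    ← lintegral_const_mul' _ _ ENNReal.ofReal_ne_top]
  refine setLIntegral_mono' measurableSet_Ioi fun u (hu : 0 < u) ↦ ?_
  simp only [norm_rpow_smul_sphere hu]
  rw [lintegral_mul_const _ (by fun_prop), radialDensity, ENNReal.mul_rpow_of_nonneg _ _ hp0.le,
    ENNReal.ofReal_rpow_of_nonneg (by positivity) hp0.le]
  refine (mul_le_mul_right (lintegral_rpow_le_measure_univ_rpow_mul μ.toSphere hp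
    (by fun_prop)) _).trans_eq ?_
  rw [toSphere_univ_eq_ofReal hμ, ENNReal.ofReal_rpow_of_nonneg (by positivity) (by linarith),
    ← mul_assoc, ← ENNReal.ofReal_mul (by positivity), mul_left_comm, mul_comm (∫⁻ _, _ ∂_),
    ← mul_assoc, ← mul_assoc, ← ENNReal.ofReal_mul (by positivity),
    ← ENNReal.ofReal_mul (by positivity)]
  congr 2
  rw [hγ, ← Real.rpow_mul hu.le,
    show 1 / a * ((Module.finrank ℝ E - a) * (p - 1)) = (Module.finrank ℝ E / a - 1) * (p - 1) by
      field_simp, Real.rpow_mul hu.le, mul_assoc, ← Real.mul_rpow (by positivity) (by positivity)]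
  set X := 1 / a * u ^ ((Module.finrank ℝ E : ℝ) / a - 1) with hX
  have hX0 : 0 < X := by positivity
  have e : X ^ p = X * X ^ (p - 1) := by
    rw [Real.rpow_sub_one hX0.ne']; field_simp
  rw [e, mul_assoc, ← Real.mul_rpow hX0.le (by positivity), hX]
  ring_nf

lemma radialDensity_blissExtremal {a l v t : ℝ} (ha : 0 < a) (hv : 0 < v)
    (hμ : μ (Metric.ball 0 1) = ENNReal.ofReal v) (ht : 0 < t) :
    radialDensity μ a (blissExtremal a l) t = ENNReal.ofReal (Module.finrank ℝ E * v / a) *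
      ENNReal.ofReal ((1 + t ^ l) ^ (-((1 + l) / l))) := by
  have hd : (0 : ℝ) < Module.finrank ℝ E := Nat.cast_pos.2 Module.finrank_pos
  simp only [radialDensity, blissExtremal_smul_sphere ha ht, lintegral_const,
    toSphere_univ_eq_ofReal hμ]
  rw [← ENNReal.ofReal_mul (by positivity), ← ENNReal.ofReal_mul (by positivity),
    ← ENNReal.ofReal_mul (by positivity)]
  congr 1
  have e : t ^ ((Module.finrank ℝ E : ℝ) / a - 1) * t ^ (1 - (Module.finrank ℝ E : ℝ) / a) = 1 := by
    rw [← Real.rpow_add ht]; simp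
  linear_combination (1 / a * (1 + t ^ l) ^ (-((1 + l) / l)) * Module.finrank ℝ E * v) * e

lemma lintegral_blissExtremal_rpow {p q l a v γ : ℝ} (hp : 1 < p) (hl : 0 < l)
    (hq : q = p * (1 + l)) (ha : 0 < a) (hv : 0 < v)
    (hμ : μ (Metric.ball 0 1) = ENNReal.ofReal v)
    (hγ : γ = (Module.finrank ℝ E - a) * (p - 1)) :
    ∫⁻ x, blissExtremal a l x ^ p * ENNReal.ofReal (‖x‖ ^ γ) ∂μ =
      ENNReal.ofReal (Module.finrank ℝ E * v / a) *
        ENNReal.ofReal (∫ t in Ioi (0 : ℝ), (1 + t ^ l) ^ (-(q / l))) := by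
  have hp0 : 0 < p := by linarith
  have hd : (0 : ℝ) < Module.finrank ℝ E := Nat.cast_pos.2 Module.finrank_pos
  have hm : Measurable (blissExtremal a l : E → ℝ≥0∞) := measurable_blissExtremal a l
  rw [lintegral_polar_rpow μ (by fun_prop) ha, ← lintegral_one_add_rpow_rpow hp hl hq,
    ← lintegral_const_mul' _ _ ENNReal.ofReal_ne_top]
  refine setLIntegral_congr_fun measurableSet_Ioi fun u (hu : 0 < u) ↦ ?_
  simp only [norm_rpow_smul_sphere hu, blissExtremal_smul_sphere ha hu, lintegral_const,
    toSphere_univ_eq_ofReal hμ]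
  rw [ENNReal.ofReal_rpow_of_nonneg (by positivity) hp0.le,
    ENNReal.ofReal_rpow_of_nonneg (by positivity) hp0.le, ← ENNReal.ofReal_mul (by positivity),
    ← ENNReal.ofReal_mul (by positivity), ← ENNReal.ofReal_mul (by positivity),
    ← ENNReal.ofReal_mul (by positivity)]
  congr 1
  rw [Real.mul_rpow (by positivity) (by positivity), ← Real.rpow_mul hu.le, ← Real.rpow_mul hu.le]
  have e : u ^ ((Module.finrank ℝ E : ℝ) / a - 1) * u ^ ((1 - (Module.finrank ℝ E : ℝ) / a) * p) *
      u ^ (1 / a * γ) = 1 := by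
    rw [← Real.rpow_add hu, ← Real.rpow_add hu, hγ]
    convert Real.rpow_zero u using 2
    field_simp
    ring
  linear_combination
    (1 / a * ((1 + u ^ l) ^ (-((1 + l) / l))) ^ p * Module.finrank ℝ E * v) * e

end Radial

/-- The sharp constant of the weighted Hardy inequality on `ℝⁿ`. -/
noncomputable def hardyConst (n : ℕ) (γ p q : ℝ) : ℝ :=
  (omegaN n) ^ (1 / q - 1 / p) * (n : ℝ) ^ (1 / p - 1 / q) *
    ((n * (p - 1)) / (n * (p - 1) - γ)) ^ ((1 - 1 / p) + 1 / q) *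
    ((p / (p - 1)) / q) ^ (1 / q) *
    ((p / (q - p)) *
      betaFn (p / (q - p)) (p * q / ((q / (q - 1)) * (q - p)))) ^ (1 / q - 1 / p)

lemma volume_ball_zero_one_eq_omegaN {n : ℕ} (hn : 1 ≤ n) :
    volume (Metric.ball (0 : EuclideanSpace ℝ (Fin n)) 1) = ENNReal.ofReal (omegaN n / n) := by
  have : Nonempty (Fin n) := ⟨⟨0, hn⟩⟩
  have hn' : (n : ℝ) / 2 ≠ 0 := by positivity
  rw [EuclideanSpace.volume_ball]
  simp only [ENNReal.ofReal_one, one_pow, one_mul, Fintype.card_fin]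
  rw [Real.Gamma_add_one hn', omegaN, Real.sqrt_eq_rpow, ← Real.rpow_natCast,
    ← Real.rpow_mul Real.pi_pos.le]
  congr 1
  rw [show 1 / 2 * (n : ℝ) = n / 2 by ring]
  field_simp

lemma omegaN_pos {n : ℕ} (hn : 1 ≤ n) : 0 < omegaN n := by
  have : 0 < Real.Gamma ((n : ℝ) / 2) := Real.Gamma_pos_of_pos (by positivity)
  unfold omegaN
  positivity

lemma mul_hardyConst_rpow {n v a p q I c : ℝ} (hn : 0 < n) (hv : 0 < v) (ha : 0 < a) (hp : 0 < p)
    (hq : 0 < q) (hI : 0 < I) (hc : 0 < c) :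
    ((n * v) ^ (1 / q - 1 / p) * n ^ (1 / p - 1 / q) * (n / a) ^ ((1 - 1 / p) + 1 / q) *
      c ^ (1 / q) * I ^ (1 / q - 1 / p)) ^ q =
    n * v / a * v ^ (-q) * ((c * I) * I ^ (-(q / p)) * ((n * v / a) ^ (p - 1)) ^ (q / p)) := by
  obtain ⟨n, rfl⟩ : ∃ x, n = Real.exp x := ⟨_, (Real.exp_log hn).symm⟩
  obtain ⟨v, rfl⟩ : ∃ x, v = Real.exp x := ⟨_, (Real.exp_log hv).symm⟩
  obtain ⟨a, rfl⟩ : ∃ x, a = Real.exp x := ⟨_, (Real.exp_log ha).symm⟩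
  obtain ⟨I, rfl⟩ : ∃ x, I = Real.exp x := ⟨_, (Real.exp_log hI).symm⟩
  obtain ⟨c, rfl⟩ : ∃ x, c = Real.exp x := ⟨_, (Real.exp_log hc).symm⟩
  simp only [← Real.exp_add, ← Real.exp_sub, ← Real.exp_mul]
  congr 1
  field_simp
  ring

lemma exists_eq_mul_one_add {p q : ℝ} (hp : 0 < p) (hpq : p < q) :
    ∃ l, 0 < l ∧ q = p * (1 + l) :=
  ⟨q / p - 1, by rwa [sub_pos, one_lt_div hp], by field_simp; ring⟩

lemma exists_eq_sub_mul {n γ p : ℝ} (hp : 1 < p) (hγ : γ < n * (p - 1)) :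
    ∃ a, 0 < a ∧ γ = (n - a) * (p - 1) :=
  ⟨n - γ / (p - 1), by rwa [sub_pos, div_lt_iff₀ (by linarith)], by
    have : p - 1 ≠ 0 := by linarith
    field_simp; ring⟩

lemma hardyConst_eq {n : ℕ} {γ p q l a : ℝ} (hp : 1 < p) (hl : 0 < l) (hq : q = p * (1 + l))
    (hγ : γ = (n - a) * (p - 1)) :
    hardyConst n γ p q = (omegaN n) ^ (1 / q - 1 / p) * (n : ℝ) ^ (1 / p - 1 / q) *
      (n / a) ^ ((1 - 1 / p) + 1 / q) * (p / (p - 1) / q) ^ (1 / q) *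
      (∫ t in Ioi (0 : ℝ), (1 + t ^ l) ^ (-(q / l))) ^ (1 / q - 1 / p) := by
  have hp1 : p - 1 ≠ 0 := by linarith
  have hp0 : p ≠ 0 := by linarith
  have hq0 : 0 < q := by rw [hq]; positivity
  have hqp : q - p = p * l := by rw [hq]; ring
  have e1 : p / (q - p) = 1 / l := by rw [hqp]; field_simp
  have e2 : p * q / (q / (q - 1) * (q - p)) = (q - 1) / l := by
    have : q - 1 ≠ 0 := by nlinarith
    rw [hqp]; field_simp
  have hg : n * (p - 1) / (n * (p - 1) - γ) = n / a := by
    rw [hγ, show n * (p - 1) - (n - a) * (p - 1) = a * (p - 1) by ring,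
      mul_div_mul_right _ _ hp1]
  rw [hardyConst, e1, e2, hg, ← integral_one_add_rpow_eq_betaFn hl]

lemma hardyConst_pos {n : ℕ} (hn : 1 ≤ n) {γ p q l a : ℝ} (hp : 1 < p) (hl : 0 < l)
    (hq : q = p * (1 + l)) (ha : 0 < a) (hγ : γ = (n - a) * (p - 1)) :
    0 < hardyConst n γ p q := by
  have hn0 : (0 : ℝ) < n := by exact_mod_cast hn
  have hp1 : 0 < p - 1 := by linarith
  have hq0 : 0 < q := by rw [hq]; positivity
  have hI := integral_one_add_rpow_pos hl (by nlinarith : 1 < q)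
  have := omegaN_pos hn
  rw [hardyConst_eq hp hl hq hγ]
  positivity

lemma hardyConst_rpow {n : ℕ} (hn : 1 ≤ n) {γ p q l a : ℝ} (hp : 1 < p) (hl : 0 < l)
    (hq : q = p * (1 + l)) (ha : 0 < a) (hγ : γ = (n - a) * (p - 1)) :
    hardyConst n γ p q ^ q = n * (omegaN n / n) / a * (omegaN n / n) ^ (-q) *
      ((∫ t in Ioi (0 : ℝ), t ^ l * (1 + t ^ l) ^ (-(q / l))) *
        (∫ t in Ioi (0 : ℝ), (1 + t ^ l) ^ (-(q / l))) ^ (-(q / p)) *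
        ((n * (omegaN n / n) / a) ^ (p - 1)) ^ (q / p)) := by
  have hn0 : (0 : ℝ) < n := by exact_mod_cast hn
  have hp1 : 0 < p - 1 := by linarith
  have hq0 : 0 < q := by rw [hq]; positivity
  have hql : 1 < q - l := by rw [hq]; nlinarith
  have hI := integral_one_add_rpow_pos hl (by linarith : 1 < q)
  have hJ : ∫ t in Ioi (0 : ℝ), t ^ l * (1 + t ^ l) ^ (-(q / l)) =
      p / (p - 1) / q * ∫ t in Ioi (0 : ℝ), (1 + t ^ l) ^ (-(q / l)) := by
    rw [integral_one_add_rpow_eq hl hql, show q - l - 1 = (p - 1) * (q / p) by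
      rw [hq]; field_simp; ring]
    field_simp
  rw [hJ, hardyConst_eq hp hl hq hγ, ← mul_hardyConst_rpow hn0 (div_pos (omegaN_pos hn) hn0) ha
    (by linarith) hq0 hI (by positivity), mul_div_cancel₀ _ hn0.ne']

/-- The weighted Hardy operator on `ℝⁿ` is bounded by `hardyConst`. -/
lemma lintegral_hardy_le {n : ℕ} (hn : 1 ≤ n) {α γ p q : ℝ} (hp : 1 < p) (hpq : p < q)
    (hγ : γ < n * (p - 1)) (hα : (α + n) / q = (γ + n) / p)
    {f : EuclideanSpace ℝ (Fin n) → ℝ≥0∞} (hf : Measurable f) :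
    ∫⁻ x : EuclideanSpace ℝ (Fin n),
        ((volume (Metric.ball (0 : EuclideanSpace ℝ (Fin n)) ‖x‖))⁻¹ *
          ∫⁻ y in Metric.ball (0 : EuclideanSpace ℝ (Fin n)) ‖x‖, f y) ^ q *
            ENNReal.ofReal (‖x‖ ^ α) ≤
      ENNReal.ofReal (hardyConst n γ p q) ^ q *
        (∫⁻ x, f x ^ p * ENNReal.ofReal (‖x‖ ^ γ)) ^ (q / p) := by
  obtain ⟨l, hl, hq⟩ := exists_eq_mul_one_add (by linarith) hpq
  obtain ⟨a, ha, hγa⟩ := exists_eq_sub_mul hp hγ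
  have hp0 : 0 < p := by linarith
  have hp1 : 0 < p - 1 := by linarith
  have hq0 : 0 < q := by linarith
  have hn0 : (0 : ℝ) < n := by exact_mod_cast hn
  have hv : 0 < omegaN n / n := div_pos (omegaN_pos hn) hn0
  have hd : Module.finrank ℝ (EuclideanSpace ℝ (Fin n)) = n := finrank_euclideanSpace_fin
  have hγd : γ = (Module.finrank ℝ (EuclideanSpace ℝ (Fin n)) - a) * (p - 1) := by
    rw [hd]; exact hγa
  have hαd : (α + Module.finrank ℝ (EuclideanSpace ℝ (Fin n))) / q =
      (γ + Module.finrank ℝ (EuclideanSpace ℝ (Fin n))) / p := by rw [hd]; exact hα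
  have : Nontrivial (EuclideanSpace ℝ (Fin n)) := Module.nontrivial_of_finrank_pos (R := ℝ)
    (by rw [hd]; exact hn)
  have hI := integral_one_add_rpow_pos hl (by linarith : 1 < q)
  have hμ := volume_ball_zero_one_eq_omegaN hn
  rw [lintegral_hardy_eq hp hl hq ha hv hμ hγd hαd hf]
  have h1 := bliss_lintegral hp hl hq (measurable_radialDensity volume a hf)
  have h2 := lintegral_radialDensity_rpow_le hp ha hv hμ hγd hf
  rw [hd] at h2 ⊢
  refine (mul_le_mul_right (h1.trans (mul_le_mul_right
    (ENNReal.rpow_le_rpow h2 (by positivity)) _)) _).trans_eq ?_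
  have hJ : 0 ≤ ∫ t in Ioi (0 : ℝ), t ^ l * (1 + t ^ l) ^ (-(q / l)) :=
    setIntegral_nonneg measurableSet_Ioi fun t (ht : 0 < t) ↦ by positivity
  rw [ENNReal.mul_rpow_of_nonneg _ _ (by positivity), ENNReal.ofReal_rpow_of_pos hI,
    ENNReal.ofReal_rpow_of_nonneg (by positivity) (by positivity),
    ENNReal.ofReal_rpow_of_nonneg (hardyConst_pos hn hp hl hq ha hγa).le hq0.le,
    hardyConst_rpow hn hp hl hq ha hγa,
    ENNReal.ofReal_mul (p := _ * _ ^ (-q)) (by positivity),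
    ENNReal.ofReal_mul (p := _ * _ ^ (-(q / p))) (by positivity), ENNReal.ofReal_mul hJ]
  ring

/-- Equality is attained in the weighted Hardy inequality on `ℝⁿ`. -/
lemma exists_lintegral_hardy_eq {n : ℕ} (hn : 1 ≤ n) {α γ p q : ℝ} (hp : 1 < p) (hpq : p < q)
    (hγ : γ < n * (p - 1)) (hα : (α + n) / q = (γ + n) / p) :
    ∃ f : EuclideanSpace ℝ (Fin n) → ℝ≥0∞, Measurable f ∧
      ∫⁻ x, f x ^ p * ENNReal.ofReal (‖x‖ ^ γ) ≠ 0 ∧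
      ∫⁻ x, f x ^ p * ENNReal.ofReal (‖x‖ ^ γ) ≠ ⊤ ∧
      ∫⁻ x : EuclideanSpace ℝ (Fin n),
        ((volume (Metric.ball (0 : EuclideanSpace ℝ (Fin n)) ‖x‖))⁻¹ *
            ∫⁻ y in Metric.ball (0 : EuclideanSpace ℝ (Fin n)) ‖x‖, f y) ^ q *
              ENNReal.ofReal (‖x‖ ^ α) =
        ENNReal.ofReal (hardyConst n γ p q) ^ q *
          (∫⁻ x, f x ^ p * ENNReal.ofReal (‖x‖ ^ γ)) ^ (q / p) := by
  obtain ⟨l, hl, hq⟩ := exists_eq_mul_one_add (by linarith) hpq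
  obtain ⟨a, ha, hγa⟩ := exists_eq_sub_mul hp hγ
  have hp0 : 0 < p := by linarith
  have hp1 : 0 < p - 1 := by linarith
  have hq0 : 0 < q := by linarith
  have hn0 : (0 : ℝ) < n := by exact_mod_cast hn
  have hv : 0 < omegaN n / n := div_pos (omegaN_pos hn) hn0
  have hd : Module.finrank ℝ (EuclideanSpace ℝ (Fin n)) = n := finrank_euclideanSpace_fin
  have hγd : γ = (Module.finrank ℝ (EuclideanSpace ℝ (Fin n)) - a) * (p - 1) := by
    rw [hd]; exact hγa
  have hαd : (α + Module.finrank ℝ (EuclideanSpace ℝ (Fin n))) / q =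
      (γ + Module.finrank ℝ (EuclideanSpace ℝ (Fin n))) / p := by rw [hd]; exact hα
  have : Nontrivial (EuclideanSpace ℝ (Fin n)) := Module.nontrivial_of_finrank_pos (R := ℝ)
    (by rw [hd]; exact hn)
  have hI := integral_one_add_rpow_pos hl (by linarith : 1 < q)
  have hμ := volume_ball_zero_one_eq_omegaN hn
  have hN := lintegral_blissExtremal_rpow hp hl hq ha hv hμ hγd
  rw [hd, ← ENNReal.ofReal_mul (by positivity)] at hN
  refine ⟨blissExtremal a l, measurable_blissExtremal a l, ?_, ?_, ?_⟩
  · rw [hN]; exact (ENNReal.ofReal_pos.2 (by positivity)).ne'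
  · rw [hN]; exact ENNReal.ofReal_ne_top
  have hJ : 0 ≤ ∫ t in Ioi (0 : ℝ), t ^ l * (1 + t ^ l) ^ (-(q / l)) :=
    setIntegral_nonneg measurableSet_Ioi fun t (ht : 0 < t) ↦ by positivity
  rw [lintegral_hardy_eq hp hl hq ha hv hμ hγd hαd
    (measurable_blissExtremal a l), hN]
  have h1 : ∀ u ∈ Ioi (0 : ℝ),
      (∫⁻ t in Ioo 0 u, radialDensity volume a
        (blissExtremal a l : EuclideanSpace ℝ (Fin n) → ℝ≥0∞) t) ^ q *
          ENNReal.ofReal (u ^ (l - q)) =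
      ENNReal.ofReal (n * (omegaN n / n) / a) ^ q *
        ((∫⁻ t in Ioo 0 u, ENNReal.ofReal ((1 + t ^ l) ^ (-((1 + l) / l)))) ^ q *
          ENNReal.ofReal (u ^ (l - q))) := by
    intro u _
    rw [setLIntegral_congr_fun measurableSet_Ioo fun t ht ↦
      radialDensity_blissExtremal (μ := volume) ha hv hμ ht.1,
      lintegral_const_mul' _ _ ENNReal.ofReal_ne_top, ENNReal.mul_rpow_of_nonneg _ _ hq0.le, hd,
      mul_assoc]
  rw [setLIntegral_congr_fun measurableSet_Ioi h1, lintegral_const_mul' _ _ (by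
    exact ENNReal.rpow_ne_top_of_nonneg hq0.le ENNReal.ofReal_ne_top),
    lintegral_one_add_rpow_primitive hp hl hq, hd,
    ENNReal.ofReal_rpow_of_nonneg (by positivity) hq0.le,
    ENNReal.ofReal_rpow_of_nonneg (hardyConst_pos hn hp hl hq ha hγa).le hq0.le,
    ENNReal.ofReal_rpow_of_nonneg (p := q / p) (by positivity) (by positivity),
    hardyConst_rpow hn hp hl hq ha hγa, ← ENNReal.ofReal_mul (by positivity),
    ← ENNReal.ofReal_mul (by positivity), ← ENNReal.ofReal_mul (by positivity)]
  congr 1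
  set w := n * (omegaN n / n) / a
  have hw : 0 < w := by positivity
  have e1 : (w * ∫ t in Ioi (0 : ℝ), (1 + t ^ l) ^ (-(q / l))) ^ (q / p) =
      w ^ (q / p) * (∫ t in Ioi (0 : ℝ), (1 + t ^ l) ^ (-(q / l))) ^ (q / p) :=
    Real.mul_rpow hw.le hI.le
  have e2 : (∫ t in Ioi (0 : ℝ), (1 + t ^ l) ^ (-(q / l))) ^ (-(q / p)) *
      (∫ t in Ioi (0 : ℝ), (1 + t ^ l) ^ (-(q / l))) ^ (q / p) = 1 := by
    rw [← Real.rpow_add hI]; simp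
  have e3 : (w ^ (p - 1)) ^ (q / p) * w ^ (q / p) = w ^ q := by
    rw [← Real.rpow_mul hw.le, ← Real.rpow_add hw]
    congr 1
    field_simp
    ring
  rw [e1, ← e3]
  linear_combination (-(w * (omegaN n / n) ^ (-q) * (w ^ (p - 1)) ^ (q / p) * w ^ (q / p) *
    ∫ t in Ioi (0 : ℝ), t ^ l * (1 + t ^ l) ^ (-(q / l)))) * e2

/-- Minkowski's integral inequality. -/
lemma lintegral_lintegral_rpow_le {X Y : Type*} [MeasurableSpace X] [MeasurableSpace Y]
    (μ : Measure X) [SigmaFinite μ] (ν : Measure Y) [SFinite ν] {s : ℝ} (hs : 1 < s)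
    {H : X → Y → ℝ≥0∞} (hH : Measurable (Function.uncurry H)) :
    ∫⁻ x, (∫⁻ y, H x y ∂ν) ^ s ∂μ ≤ (∫⁻ y, (∫⁻ x, H x y ^ s ∂μ) ^ (1 / s) ∂ν) ^ s := by
  have hs0 : 0 < s := by linarith
  have hHx (y : Y) : Measurable fun x ↦ H x y := hH.comp (measurable_id.prodMk measurable_const)
  have hΦ : Measurable fun x ↦ ∫⁻ y, H x y ∂ν := hH.lintegral_prod_right'
  set Φ := fun x ↦ ∫⁻ y, H x y ∂ν
  set M := ∫⁻ y, (∫⁻ x, H x y ^ s ∂μ) ^ (1 / s) ∂ν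
  have key : ∀ φ : X → ℝ≥0∞, Measurable φ → φ ≤ Φ → ∫⁻ x, φ x ^ s ∂μ ≠ ⊤ →
      ∫⁻ x, φ x ^ s ∂μ ≤ M ^ s := by
    intro φ hφ hle hfin
    rcases eq_or_ne (∫⁻ x, φ x ^ s ∂μ) 0 with h0 | h0
    · rw [h0]; exact zero_le
    have hc : s.HolderConjugate (Real.conjExponent s) := Real.HolderConjugate.conjExponent hs
    have hcs : (s - 1) * Real.conjExponent s = s := by
      rw [Real.conjExponent]; have : s - 1 ≠ 0 := by linarith
      field_simp
    have hci : 1 / Real.conjExponent s = 1 - 1 / s := by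
      rw [one_div, one_div, ← hc.one_sub_inv]
    have h1 : ∫⁻ x, φ x ^ s ∂μ ≤ M * (∫⁻ x, φ x ^ s ∂μ) ^ (1 - 1 / s) := by
      calc ∫⁻ x, φ x ^ s ∂μ ≤ ∫⁻ x, ∫⁻ y, H x y * φ x ^ (s - 1) ∂ν ∂μ := by
            refine lintegral_mono fun x ↦ ?_
            rw [lintegral_mul_const _ (by exact hH.comp measurable_prodMk_left)]
            refine le_trans (le_of_eq ?_) (mul_le_mul_left (hle x) _)
            conv_rhs => rw [← ENNReal.rpow_one (φ x), ← ENNReal.rpow_mul, one_mul,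
              ← ENNReal.rpow_add_of_nonneg _ _ zero_le_one (by linarith)]
            congr 1; ring
        _ = ∫⁻ y, ∫⁻ x, H x y * φ x ^ (s - 1) ∂μ ∂ν :=
            lintegral_lintegral_swap (hH.mul ((hφ.comp measurable_fst).pow_const _)).aemeasurable
        _ ≤ ∫⁻ y, (∫⁻ x, H x y ^ s ∂μ) ^ (1 / s) * (∫⁻ x, φ x ^ s ∂μ) ^ (1 - 1 / s) ∂ν := by
            refine lintegral_mono fun y ↦ ?_
            have := ENNReal.lintegral_mul_le_Lp_mul_Lq μ hc (hHx y).aemeasurable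
              (hφ.pow_const (s - 1)).aemeasurable
            simpa only [Pi.mul_apply, ← ENNReal.rpow_mul, hcs, hci] using this
        _ = _ := lintegral_mul_const _ (by
            have : Measurable fun y ↦ ∫⁻ x, H x y ^ s ∂μ :=
              (hH.pow_const s).lintegral_prod_left'
            exact this.pow_const _)
    have h2 : ∫⁻ x, φ x ^ s ∂μ = (∫⁻ x, φ x ^ s ∂μ) ^ (1 / s) *
        (∫⁻ x, φ x ^ s ∂μ) ^ (1 - 1 / s) := by
      rw [← ENNReal.rpow_add _ _ h0 hfin]; simp
    have hs1 : 0 ≤ 1 - 1 / s := by rw [sub_nonneg, div_le_one hs0]; exact hs.le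
    have h3 := (ENNReal.mul_le_mul_iff_left (ENNReal.rpow_pos (pos_iff_ne_zero.2 h0) hfin).ne'
      (ENNReal.rpow_ne_top_of_nonneg hs1 hfin)).1 (h2.symm.trans_le h1)
    have h4 := ENNReal.rpow_le_rpow h3 hs0.le
    rwa [← ENNReal.rpow_mul, one_div_mul_cancel hs0.ne', ENNReal.rpow_one] at h4
  set φ : ℕ → X → ℝ≥0∞ := fun k ↦ (spanningSets μ k).indicator fun x ↦ min (Φ x) k
  have hφm (k : ℕ) : Measurable (φ k) :=
    (hΦ.min measurable_const).indicator (measurableSet_spanningSets μ k)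
  have hmono (x : X) : Monotone fun k ↦ φ k x ^ s := by
    intro i j hij
    refine ENNReal.rpow_le_rpow ?_ hs0.le
    refine (indicator_le_indicator_of_subset (monotone_spanningSets μ hij) (fun _ ↦ zero_le) x).trans
      (indicator_le_indicator ?_)
    gcongr
  have hlim (x : X) : Filter.Tendsto (fun k ↦ φ k x ^ s) Filter.atTop (nhds (Φ x ^ s)) := by
    refine (ENNReal.continuous_rpow_const.tendsto _).comp ?_
    have : Filter.Tendsto (fun k : ℕ ↦ min (Φ x) (k : ℝ≥0∞)) Filter.atTop (nhds (Φ x)) := by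
      simpa using (tendsto_const_nhds (x := Φ x)).min ENNReal.tendsto_nat_nhds_top
    refine this.congr' ?_
    filter_upwards [Filter.eventually_ge_atTop (spanningSetsIndex μ x)] with k hk
    exact (indicator_of_mem (monotone_spanningSets μ hk (mem_spanningSetsIndex μ x))
      fun x ↦ min (Φ x) (k : ℝ≥0∞)).symm
  refine le_of_tendsto' (lintegral_tendsto_of_tendsto_of_monotone
    (fun k ↦ ((hφm k).pow_const s).aemeasurable) (.of_forall hmono) (.of_forall hlim)) fun k ↦
    key _ (hφm k) (fun x ↦ (indicator_le_self _ _ x).trans (min_le_left _ _)) ?_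
  have hk : ∫⁻ x, φ k x ^ s ∂μ ≤
      ∫⁻ x, (spanningSets μ k).indicator (fun _ ↦ (k : ℝ≥0∞) ^ s) x ∂μ := by
    refine lintegral_mono fun x ↦ ?_
    by_cases hx : x ∈ spanningSets μ k
    · simp only [φ, indicator_of_mem hx]
      exact ENNReal.rpow_le_rpow (min_le_right _ _) hs0.le
    · simp [φ, indicator_of_notMem hx, hs0]
  refine (hk.trans_lt ?_).ne
  rw [lintegral_indicator_const (measurableSet_spanningSets μ k)]
  exact ENNReal.mul_lt_top (ENNReal.rpow_lt_top_of_nonneg hs0.le (ENNReal.natCast_ne_top k))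
    (measure_spanningSets_lt_top μ k)

section KernelBound

variable {X Y : Type*} [MeasurableSpace X] [MeasurableSpace Y]

/-- The integral operator with kernel `K` is bounded from `L^p(U μ)` to `L^q(W μ)`, with norm at
most `A ^ (1 / q)`. -/
def KernelBound (μ : Measure X) (K : X → X → ℝ≥0∞) (W U : X → ℝ≥0∞) (p q : ℝ) (A : ℝ≥0∞) :
    Prop :=
  ∀ f : X → ℝ≥0∞, Measurable f →
    ∫⁻ x, (∫⁻ y, K x y * f y ∂μ) ^ q * W x ∂μ ≤ A * (∫⁻ x, f x ^ p * U x ∂μ) ^ (q / p)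

lemma KernelBound.comp_measurableEquiv {μ : Measure X} {ν : Measure Y} {K : Y → Y → ℝ≥0∞}
    {W U : Y → ℝ≥0∞} {p q : ℝ} {A : ℝ≥0∞} (h : KernelBound ν K W U p q A) (e : X ≃ᵐ Y)
    (he : MeasurePreserving e μ ν) :
    KernelBound μ (fun x y ↦ K (e x) (e y)) (fun x ↦ W (e x)) (fun x ↦ U (e x)) p q A := by
  intro f hf
  have hc (g : Y → ℝ≥0∞) : ∫⁻ x, g (e x) ∂μ = ∫⁻ y, g y ∂ν :=
    he.lintegral_comp_emb e.measurableEmbedding g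
  have h1 := h (f ∘ e.symm) (hf.comp e.symm.measurable)
  rw [← hc, ← hc] at h1
  simp_rw [← hc] at h1
  simpa using h1

lemma KernelBound.prod {μ : Measure X} {ν : Measure Y} [SFinite μ] [SigmaFinite ν]
    {K : X → X → ℝ≥0∞} {L : Y → Y → ℝ≥0∞} {W U : X → ℝ≥0∞} {V T : Y → ℝ≥0∞} {p q : ℝ}
    {A B : ℝ≥0∞} (hp : 0 < p) (hpq : p < q) (hKm : Measurable (Function.uncurry K))
    (hLm : Measurable (Function.uncurry L)) (hW : Measurable W) (hU : Measurable U)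
    (hV : Measurable V) (hT : Measurable T) (hK : KernelBound μ K W U p q A)
    (hL : KernelBound ν L V T p q B) :
    KernelBound (μ.prod ν) (fun z w ↦ K z.1 w.1 * L z.2 w.2) (fun z ↦ W z.1 * V z.2)
      (fun z ↦ U z.1 * T z.2) p q (A * B) := by
  intro f hf
  have hs : 1 < q / p := (one_lt_div hp).2 hpq
  have hs0 : 0 < q / p := by linarith
  have hps : p * (q / p) = q := by field_simp
  have hG : Measurable fun z : Y × X ↦ ∫⁻ y, L z.1 y * f (z.2, y) ∂ν := by
    refine Measurable.lintegral_prod_right' (f := fun z : (Y × X) × Y ↦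
      L z.1.1 z.2 * f (z.1.2, z.2)) ?_
    exact (hLm.comp (by fun_prop : Measurable fun z : (Y × X) × Y ↦ (z.1.1, z.2))).mul
      (by fun_prop)
  set G : Y → X → ℝ≥0∞ := fun x y ↦ ∫⁻ y', L x y' * f (y, y') ∂ν
  have hGx (x : Y) : Measurable (G x) := hG.comp measurable_prodMk_left
  have hGy (y : X) : Measurable fun x ↦ G x y := hG.comp measurable_prodMk_right
  have hKx (x : X) : Measurable (K x) := hKm.comp measurable_prodMk_left
  have hLx (x : Y) : Measurable (L x) := hLm.comp measurable_prodMk_left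
  have hinner (z : X × Y) : ∫⁻ w, K z.1 w.1 * L z.2 w.2 * f w ∂μ.prod ν =
      ∫⁻ y, K z.1 y * G z.2 y ∂μ := by
    rw [lintegral_prod _ (by
      exact ((((hKx z.1).comp measurable_fst).mul ((hLx z.2).comp measurable_snd)).mul
        hf).aemeasurable)]
    refine lintegral_congr fun y ↦ ?_
    simp only [mul_assoc]
    exact lintegral_const_mul _ ((hLx z.2).mul (hf.comp measurable_prodMk_left))
  have hTm : Measurable fun z : X × Y ↦ ∫⁻ y, K z.1 y * G z.2 y ∂μ := by
    refine Measurable.lintegral_prod_right' (f := fun z : (X × Y) × X ↦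
      K z.1.1 z.2 * G z.1.2 z.2) ?_
    exact (hKm.comp (by fun_prop : Measurable fun z : (X × Y) × X ↦ (z.1.1, z.2))).mul
      (hG.comp (by fun_prop : Measurable fun z : (X × Y) × X ↦ (z.1.2, z.2)))
  have hfT : Measurable fun y ↦ ∫⁻ y', f (y, y') ^ p * T y' ∂ν :=
    Measurable.lintegral_prod_right' (f := fun z : X × Y ↦ f z ^ p * T z.2) (by fun_prop)
  calc ∫⁻ z, (∫⁻ w, K z.1 w.1 * L z.2 w.2 * f w ∂μ.prod ν) ^ q * (W z.1 * V z.2) ∂μ.prod ν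
      = ∫⁻ x', (∫⁻ x, (∫⁻ y, K x y * G x' y ∂μ) ^ q * W x ∂μ) * V x' ∂ν := by
        simp_rw [hinner]
        rw [lintegral_prod_symm' _ (by fun_prop)]
        refine lintegral_congr fun x' ↦ ?_
        simp only [← mul_assoc]
        exact lintegral_mul_const _
          (((hTm.comp measurable_prodMk_right).pow_const q).mul hW)
    _ ≤ ∫⁻ x', A * (∫⁻ y, G x' y ^ p * U y * V x' ^ (1 / (q / p)) ∂μ) ^ (q / p) ∂ν := by
        refine lintegral_mono fun x' ↦ ?_
        rw [lintegral_mul_const _ (by exact ((hGx x').pow_const p).mul hU),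
          ENNReal.mul_rpow_of_nonneg _ _ hs0.le, ← ENNReal.rpow_mul,
          one_div_mul_cancel hs0.ne', ENNReal.rpow_one, ← mul_assoc]
        exact mul_le_mul_left (hK _ (hGx x')) _
    _ ≤ A * (∫⁻ y, (∫⁻ x', (G x' y ^ p * U y * V x' ^ (1 / (q / p))) ^ (q / p) ∂ν) ^
          (1 / (q / p)) ∂μ) ^ (q / p) := by
        have hH : Measurable (Function.uncurry fun x' y ↦
            G x' y ^ p * U y * V x' ^ (1 / (q / p))) :=
          ((hG.pow_const p).mul (hU.comp measurable_snd)).mul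
            ((hV.comp measurable_fst).pow_const _)
        rw [lintegral_const_mul _ (by exact hH.lintegral_prod_right'.pow_const _)]
        exact mul_le_mul_right (lintegral_lintegral_rpow_le ν μ hs hH) _
    _ ≤ A * (∫⁻ y, B ^ (1 / (q / p)) * ((∫⁻ y', f (y, y') ^ p * T y' ∂ν) * U y) ∂μ) ^ (q / p) := by
        refine mul_le_mul_right (ENNReal.rpow_le_rpow (lintegral_mono fun y ↦ ?_) hs0.le) _
        have e (x' : Y) : (G x' y ^ p * U y * V x' ^ (1 / (q / p))) ^ (q / p) =
            G x' y ^ q * V x' * U y ^ (q / p) := by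
          rw [ENNReal.mul_rpow_of_nonneg _ _ hs0.le, ENNReal.mul_rpow_of_nonneg _ _ hs0.le,
            ← ENNReal.rpow_mul, ← ENNReal.rpow_mul, hps, one_div_mul_cancel hs0.ne',
            ENNReal.rpow_one]
          ring
        simp_rw [e]
        rw [lintegral_mul_const _ (by exact ((hGy y).pow_const q).mul hV)]
        refine (ENNReal.rpow_le_rpow (mul_le_mul_left (hL (fun y' ↦ f (y, y'))
          (hf.comp measurable_prodMk_left)) _) (by positivity)).trans_eq ?_
        rw [ENNReal.mul_rpow_of_nonneg _ _ (by positivity),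
          ENNReal.mul_rpow_of_nonneg _ _ (by positivity), ← ENNReal.rpow_mul,
          ← ENNReal.rpow_mul, mul_one_div_cancel hs0.ne', ENNReal.rpow_one, ENNReal.rpow_one,
          mul_assoc]
    _ = A * B * (∫⁻ z, f z ^ p * (U z.1 * T z.2) ∂μ.prod ν) ^ (q / p) := by
        rw [lintegral_const_mul _ (by exact hfT.mul hU), ENNReal.mul_rpow_of_nonneg _ _ hs0.le,
          ← ENNReal.rpow_mul, one_div_mul_cancel hs0.ne', ENNReal.rpow_one, ← mul_assoc,
          lintegral_prod _ (by fun_prop)]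
        congr 2
        refine lintegral_congr fun y ↦ ?_
        rw [← lintegral_mul_const _ (by
          exact ((hf.comp measurable_prodMk_left).pow_const p).mul hT)]
        refine lintegral_congr fun y' ↦ ?_
        ring

end KernelBound

lemma lintegral_pi_eq_lintegral_prod {m : ℕ} {X : Fin (m + 1) → Type*}
    [∀ i, MeasureSpace (X i)] [∀ i, SigmaFinite (volume : Measure (X i))]
    (g : X 0 × (∀ j, X (Fin.succAbove 0 j)) → ℝ≥0∞) :
    ∫⁻ x : ∀ i, X i, g (x 0, fun j ↦ x (Fin.succAbove 0 j)) = ∫⁻ z, g z :=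
  (volume_preserving_piFinSuccAbove X 0).lintegral_comp_emb
    (MeasurableEquiv.piFinSuccAbove X 0).measurableEmbedding g

lemma lintegral_prod_apply {m : ℕ} {X : Fin m → Type*} [∀ i, MeasureSpace (X i)]
    [∀ i, SigmaFinite (volume : Measure (X i))] {f : ∀ i, X i → ℝ≥0∞}
    (hf : ∀ i, Measurable (f i)) :
    ∫⁻ x : ∀ i, X i, ∏ i, f i (x i) = ∏ i, ∫⁻ x, f i x := by
  induction m with
  | zero => simp [volume_pi]
  | succ m ih =>
    simp only [Fin.prod_univ_succAbove _ 0]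
    rw [← ih fun j ↦ hf _]
    have h := lintegral_pi_eq_lintegral_prod (X := X) fun z ↦
      f 0 z.1 * ∏ j, f (Fin.succAbove 0 j) (z.2 j)
    refine h.trans (lintegral_prod_mul (g := fun y : ∀ j, X (Fin.succAbove 0 j) ↦
      ∏ j, f (Fin.succAbove 0 j) (y j)) (hf 0).aemeasurable ?_)
    exact (Finset.measurable_prod _ fun j _ ↦ (hf _).comp (measurable_pi_apply j)).aemeasurable

lemma KernelBound.pi {m : ℕ} {X : Fin m → Type*} [∀ i, MeasureSpace (X i)]
    [∀ i, SigmaFinite (volume : Measure (X i))] {K : ∀ i, X i → X i → ℝ≥0∞}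
    {W U : ∀ i, X i → ℝ≥0∞} {p q : ℝ} {A : Fin m → ℝ≥0∞} (hp : 0 < p) (hpq : p < q)
    (hKm : ∀ i, Measurable (Function.uncurry (K i))) (hW : ∀ i, Measurable (W i))
    (hU : ∀ i, Measurable (U i)) (h : ∀ i, KernelBound volume (K i) (W i) (U i) p q (A i)) :
    KernelBound volume (fun x y : ∀ i, X i ↦ ∏ i, K i (x i) (y i)) (fun x ↦ ∏ i, W i (x i))
      (fun x ↦ ∏ i, U i (x i)) p q (∏ i, A i) := by
  induction m with
  | zero =>
    intro f _
    simp [lintegral_unique, volume_pi, ← ENNReal.rpow_mul, mul_div_cancel₀ _ hp.ne']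
  | succ m ih =>
    have h1 := ((h 0).prod hp hpq (hKm 0) ?_ (hW 0) (hU 0) ?_ ?_
      (ih (fun j ↦ hKm (Fin.succAbove 0 j)) (fun j ↦ hW _) (fun j ↦ hU _)
        fun j ↦ h _)).comp_measurableEquiv _ (volume_preserving_piFinSuccAbove X 0)
    · simp only [Fin.prod_univ_succAbove _ 0]
      exact h1
    · refine Finset.measurable_prod _ fun j _ ↦ (hKm (Fin.succAbove 0 j)).comp
        (f := fun a : (∀ j, X (Fin.succAbove 0 j)) × (∀ j, X (Fin.succAbove 0 j)) ↦ (a.1 j, a.2 j)) ?_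
      fun_prop
    · exact Finset.measurable_prod _ fun j _ ↦ (hW _).comp (measurable_pi_apply j)
    · exact Finset.measurable_prod _ fun j _ ↦ (hU _).comp (measurable_pi_apply j)

/-- The kernel of the Hardy operator on `ℝⁿ`. -/
noncomputable def hardyKernel {n : ℕ} (x y : EuclideanSpace ℝ (Fin n)) : ℝ≥0∞ :=
  (volume (Metric.ball (0 : EuclideanSpace ℝ (Fin n)) ‖x‖))⁻¹ *
    (Metric.ball (0 : EuclideanSpace ℝ (Fin n)) ‖x‖).indicator 1 y

lemma measurable_hardyKernel {n : ℕ} : Measurable (Function.uncurry (hardyKernel (n := n))) := by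
  have hb : Measurable fun x : EuclideanSpace ℝ (Fin n) ↦
      volume (Metric.ball (0 : EuclideanSpace ℝ (Fin n)) ‖x‖) := by
    simpa using measurable_lintegral_ball volume (f := fun _ ↦ 1) measurable_const
  have hs : MeasurableSet {z : EuclideanSpace ℝ (Fin n) × EuclideanSpace ℝ (Fin n) |
      ‖z.2‖ < ‖z.1‖} := measurableSet_lt (by fun_prop) (by fun_prop)
  refine (hb.comp measurable_fst).inv.mul ?_
  convert (measurable_one (α := ℝ≥0∞)).indicator hs using 2 with z
  simp [indicator]

lemma lintegral_hardyKernel_mul {n : ℕ} (x : EuclideanSpace ℝ (Fin n))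
    {f : EuclideanSpace ℝ (Fin n) → ℝ≥0∞} (hf : Measurable f) :
    ∫⁻ y, hardyKernel x y * f y = (volume (Metric.ball (0 : EuclideanSpace ℝ (Fin n)) ‖x‖))⁻¹ *
      ∫⁻ y in Metric.ball 0 ‖x‖, f y := by
  have hb := Metric.isOpen_ball.measurableSet (s := Metric.ball (0 : EuclideanSpace ℝ (Fin n)) ‖x‖)
  have e (y) : (Metric.ball (0 : EuclideanSpace ℝ (Fin n)) ‖x‖).indicator 1 y * f y =
      (Metric.ball 0 ‖x‖).indicator f y := by
    by_cases hy : y ∈ Metric.ball 0 ‖x‖ <;> simp [indicator]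
  simp only [hardyKernel, mul_assoc, e]
  rw [lintegral_const_mul _ (hf.indicator hb), lintegral_indicator hb]

lemma prodHardy_eq_lintegral {m : ℕ} {n : Fin m → ℕ}
    {f : (∀ i, EuclideanSpace ℝ (Fin (n i))) → ℝ≥0∞} (hf : Measurable f)
    (x : ∀ i, EuclideanSpace ℝ (Fin (n i))) :
    prodHardy m n f x = ∫⁻ y, (∏ i, hardyKernel (x i) (y i)) * f y := by
  have hs : MeasurableSet {y : ∀ i, EuclideanSpace ℝ (Fin (n i)) | ∀ i, ‖y i‖ < ‖x i‖} := by
    simp only [ofPred_forall]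
    exact MeasurableSet.iInter fun i ↦ measurableSet_lt (by fun_prop) measurable_const
  rw [prodHardy, ← lintegral_indicator hs, ← lintegral_const_mul _ (hf.indicator hs)]
  refine lintegral_congr fun y ↦ ?_
  simp only [hardyKernel, Finset.prod_mul_distrib, mul_assoc]
  congr 1
  by_cases hy : ∀ i, ‖y i‖ < ‖x i‖
  · rw [indicator_of_mem (by exact hy), Finset.prod_eq_one, one_mul]
    intro i _
    exact indicator_of_mem (by simpa using hy i) _
  · rw [indicator_of_notMem (by exact hy)]
    push Not at hy
    obtain ⟨i, hi⟩ := hy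
    rw [Finset.prod_eq_zero (Finset.mem_univ i), zero_mul]
    exact indicator_of_notMem (by simpa using hi) _

lemma kernelBound_hardyKernel {n : ℕ} (hn : 1 ≤ n) {α γ p q : ℝ} (hp : 1 < p) (hpq : p < q)
    (hγ : γ < n * (p - 1)) (hα : (α + n) / q = (γ + n) / p) :
    KernelBound volume (hardyKernel (n := n)) (fun x ↦ ENNReal.ofReal (‖x‖ ^ α))
      (fun x ↦ ENNReal.ofReal (‖x‖ ^ γ)) p q (ENNReal.ofReal (hardyConst n γ p q) ^ q) := by
  intro f hf
  simp_rw [lintegral_hardyKernel_mul _ hf]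
  exact lintegral_hardy_le hn hp hpq hγ hα hf

lemma ofReal_prod_norm_rpow {m : ℕ} {n : Fin m → ℕ} (α : Fin m → ℝ)
    (x : ∀ i, EuclideanSpace ℝ (Fin (n i))) :
    ENNReal.ofReal (∏ i, ‖x i‖ ^ α i) = ∏ i, ENNReal.ofReal (‖x i‖ ^ α i) :=
  ENNReal.ofReal_prod_of_nonneg fun i _ ↦ by positivity

lemma lintegral_prodHardy_le {m : ℕ} {n : Fin m → ℕ} (hn : ∀ i, 1 ≤ n i) {α γ : Fin m → ℝ}
    {p q : ℝ} (hp : 1 < p) (hpq : p < q) (hγ : ∀ i, γ i < n i * (p - 1))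
    (hα : ∀ i, (α i + n i) / q = (γ i + n i) / p)
    {f : (∀ i, EuclideanSpace ℝ (Fin (n i))) → ℝ≥0∞} (hf : Measurable f) :
    (∫⁻ x, prodHardy m n f x ^ q * ENNReal.ofReal (∏ i, ‖x i‖ ^ α i)) ^ (1 / q) ≤
      (∏ i, ENNReal.ofReal (hardyConst (n i) (γ i) p q)) *
        (∫⁻ x, f x ^ p * ENNReal.ofReal (∏ i, ‖x i‖ ^ γ i)) ^ (1 / p) := by
  have hq0 : 0 < q := by linarith
  have h := KernelBound.pi (by linarith) hpq (fun i ↦ measurable_hardyKernel (n := n i))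
    (fun i ↦ by fun_prop) (fun i ↦ by fun_prop)
    (fun i ↦ kernelBound_hardyKernel (hn i) hp hpq (hγ i) (hα i)) f hf
  simp_rw [ofReal_prod_norm_rpow, prodHardy_eq_lintegral hf]
  refine (ENNReal.rpow_le_rpow h (by positivity : 0 ≤ 1 / q)).trans_eq ?_
  rw [ENNReal.mul_rpow_of_nonneg _ _ (by positivity), ENNReal.prod_rpow_of_nonneg hq0.le,
    ← ENNReal.rpow_mul, ← ENNReal.rpow_mul, mul_one_div_cancel hq0.ne', ENNReal.rpow_one]
  congr 2
  field_simp

lemma exists_lintegral_prodHardy_eq {m : ℕ} {n : Fin m → ℕ} (hn : ∀ i, 1 ≤ n i)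
    {α γ : Fin m → ℝ} {p q : ℝ} (hp : 1 < p) (hpq : p < q) (hγ : ∀ i, γ i < n i * (p - 1))
    (hα : ∀ i, (α i + n i) / q = (γ i + n i) / p) :
    ∃ f : (∀ i, EuclideanSpace ℝ (Fin (n i))) → ℝ≥0∞, Measurable f ∧
      ∫⁻ x, f x ^ p * ENNReal.ofReal (∏ i, ‖x i‖ ^ γ i) ≠ 0 ∧
      ∫⁻ x, f x ^ p * ENNReal.ofReal (∏ i, ‖x i‖ ^ γ i) ≠ ⊤ ∧
      (∫⁻ x, prodHardy m n f x ^ q * ENNReal.ofReal (∏ i, ‖x i‖ ^ α i)) ^ (1 / q) =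
        (∏ i, ENNReal.ofReal (hardyConst (n i) (γ i) p q)) *
          (∫⁻ x, f x ^ p * ENNReal.ofReal (∏ i, ‖x i‖ ^ γ i)) ^ (1 / p) := by
  have hp0 : 0 < p := by linarith
  have hq0 : 0 < q := by linarith
  choose f hf h0 ht heq using fun i ↦ exists_lintegral_hardy_eq (hn i) hp hpq (hγ i) (hα i)
  have hF : Measurable fun x : ∀ i, EuclideanSpace ℝ (Fin (n i)) ↦ ∏ i, f i (x i) :=
    Finset.measurable_prod _ fun i _ ↦ (hf i).comp (measurable_pi_apply i)
  have hN : ∫⁻ x : ∀ i, EuclideanSpace ℝ (Fin (n i)), (∏ i, f i (x i)) ^ p *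
      ENNReal.ofReal (∏ i, ‖x i‖ ^ γ i) =
        ∏ i, ∫⁻ x, f i x ^ p * ENNReal.ofReal (‖x‖ ^ γ i) := by
    rw [← lintegral_prod_apply fun i ↦ by fun_prop]
    refine lintegral_congr fun x ↦ ?_
    rw [ofReal_prod_norm_rpow, ← ENNReal.prod_rpow_of_nonneg hp0.le, ← Finset.prod_mul_distrib]
  have hK (x : ∀ i, EuclideanSpace ℝ (Fin (n i))) : prodHardy m n (fun x ↦ ∏ i, f i (x i)) x =
      ∏ i, ((volume (Metric.ball (0 : EuclideanSpace ℝ (Fin (n i))) ‖x i‖))⁻¹ *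
        ∫⁻ y in Metric.ball 0 ‖x i‖, f i y) := by
    rw [prodHardy_eq_lintegral hF]
    simp_rw [← Finset.prod_mul_distrib, ← lintegral_hardyKernel_mul _ (hf _)]
    exact lintegral_prod_apply fun i ↦
      (measurable_hardyKernel.comp measurable_prodMk_left).mul (hf i)
  have hH : ∫⁻ x, prodHardy m n (fun x ↦ ∏ i, f i (x i)) x ^ q *
      ENNReal.ofReal (∏ i, ‖x i‖ ^ α i) =
        ∏ i, (ENNReal.ofReal (hardyConst (n i) (γ i) p q) ^ q *
          (∫⁻ x, f i x ^ p * ENNReal.ofReal (‖x‖ ^ γ i)) ^ (q / p)) := by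
    simp_rw [← heq, hK, ofReal_prod_norm_rpow, ← ENNReal.prod_rpow_of_nonneg hq0.le,
      ← Finset.prod_mul_distrib]
    refine lintegral_prod_apply (X := fun i ↦ EuclideanSpace ℝ (Fin (n i)))
      (f := fun i x ↦ ((volume (Metric.ball (0 : EuclideanSpace ℝ (Fin (n i))) ‖x‖))⁻¹ *
        ∫⁻ y in Metric.ball 0 ‖x‖, f i y) ^ q * ENNReal.ofReal (‖x‖ ^ α i)) fun i ↦ ?_
    simp_rw [← lintegral_hardyKernel_mul _ (hf i)]
    have : Measurable fun x ↦ ∫⁻ y, hardyKernel x y * f i y :=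
      Measurable.lintegral_prod_right' (measurable_hardyKernel.mul ((hf i).comp measurable_snd))
    fun_prop
  refine ⟨fun x ↦ ∏ i, f i (x i), hF, ?_, ?_, ?_⟩
  · rw [hN]; exact Finset.prod_ne_zero_iff.2 fun i _ ↦ h0 i
  · rw [hN]; exact ENNReal.prod_ne_top fun i _ ↦ ht i
  · rw [hN, hH, Finset.prod_mul_distrib, ENNReal.mul_rpow_of_nonneg _ _ (by positivity),
      ENNReal.prod_rpow_of_nonneg hq0.le, ENNReal.prod_rpow_of_nonneg (by positivity),
      ← ENNReal.rpow_mul, ← ENNReal.rpow_mul, mul_one_div_cancel hq0.ne', ENNReal.rpow_one]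
    congr 2
    field_simp

lemma ofReal_prod_hardyConst {m : ℕ} {n : Fin m → ℕ} (hn : ∀ i, 1 ≤ n i) {γ : Fin m → ℝ}
    {p q : ℝ} (hp : 1 < p) (hpq : p < q) (hγ : ∀ i, γ i < n i * (p - 1)) :
    ENNReal.ofReal (∏ i, hardyConst (n i) (γ i) p q) =
      ∏ i, ENNReal.ofReal (hardyConst (n i) (γ i) p q) := by
  refine ENNReal.ofReal_prod_of_nonneg fun i _ ↦ ?_
  obtain ⟨l, hl, hq⟩ := exists_eq_mul_one_add (by linarith) hpq
  obtain ⟨a, ha, hγa⟩ := exists_eq_sub_mul hp (hγ i)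
  exact (hardyConst_pos (hn i) hp hl hq ha hγa).le

/-- The operator norm of `𝓗_m : L^p(|x|^γ) → L^q(|x|^α)` equals the explicit constant. -/
theorem weighted_prodHardy_norm (m : ℕ) (hm : 1 ≤ m) (n : Fin m → ℕ)
    (hn : ∀ i, 1 ≤ n i) (α γ : Fin m → ℝ) (p q : ℝ) (hp : 1 < p) (hpq : p < q)
    (hγ : ∀ i, γ i < n i * (p - 1))
    (hscal : ∀ i, (α i + n i) / q = (γ i + n i) / p) :
    (∀ f : (∀ i, EuclideanSpace ℝ (Fin (n i))) → ℝ≥0∞, Measurable f →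
      (∫⁻ x, prodHardy m n f x ^ q * ENNReal.ofReal (∏ i, ‖x i‖ ^ α i)) ^ (1 / q)
        ≤ ENNReal.ofReal (∏ i,
            (omegaN (n i)) ^ (1 / q - 1 / p) * (n i : ℝ) ^ (1 / p - 1 / q) *
              ((n i * (p - 1)) / (n i * (p - 1) - γ i)) ^ ((1 - 1 / p) + 1 / q) *
              ((p / (p - 1)) / q) ^ (1 / q) *
              ((p / (q - p)) *
                betaFn (p / (q - p)) (p * q / ((q / (q - 1)) * (q - p)))) ^ (1 / q - 1 / p)) *
          (∫⁻ x, f x ^ p * ENNReal.ofReal (∏ i, ‖x i‖ ^ γ i)) ^ (1 / p)) ∧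
    (∀ C : ℝ≥0∞,
      (∀ f : (∀ i, EuclideanSpace ℝ (Fin (n i))) → ℝ≥0∞, Measurable f →
        (∫⁻ x, prodHardy m n f x ^ q * ENNReal.ofReal (∏ i, ‖x i‖ ^ α i)) ^ (1 / q)
          ≤ C * (∫⁻ x, f x ^ p * ENNReal.ofReal (∏ i, ‖x i‖ ^ γ i)) ^ (1 / p)) →
      ENNReal.ofReal (∏ i,
          (omegaN (n i)) ^ (1 / q - 1 / p) * (n i : ℝ) ^ (1 / p - 1 / q) *
            ((n i * (p - 1)) / (n i * (p - 1) - γ i)) ^ ((1 - 1 / p) + 1 / q) *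
            ((p / (p - 1)) / q) ^ (1 / q) *
            ((p / (q - p)) *
              betaFn (p / (q - p)) (p * q / ((q / (q - 1)) * (q - p)))) ^ (1 / q - 1 / p)) ≤ C) := by
  change (∀ f, Measurable f → _ ≤ ENNReal.ofReal (∏ i, hardyConst (n i) (γ i) p q) * _) ∧
    ∀ C, _ → ENNReal.ofReal (∏ i, hardyConst (n i) (γ i) p q) ≤ C
  rw [ofReal_prod_hardyConst hn hp hpq hγ]
  refine ⟨fun f hf ↦ lintegral_prodHardy_le hn hp hpq hγ hscal hf, fun C hC ↦ ?_⟩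
  obtain ⟨f, hf, h0, ht, heq⟩ := exists_lintegral_prodHardy_eq hn hp hpq hγ hscal
  have hp0 : 0 ≤ 1 / p := one_div_nonneg.2 (by linarith)
  exact (ENNReal.mul_le_mul_iff_left (ENNReal.rpow_pos (pos_iff_ne_zero.2 h0) ht).ne'
    (ENNReal.rpow_ne_top_of_nonneg hp0 ht)).1 (heq.symm.trans_le (hC f hf))
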